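/- Consider the RGV ensemble of rate R, composition Q_X, distance function d and threshold Δ. Fix δ > 0 and ε > 0, let P_{XX'} ∈ 𝒬(Q_X) satisfy I_P(X;X') < 2R−ε and d(P_{XX'}) > Δ, and define the event ℰ(P_{XX'}) = {N(P_{XX'}) < (1−4δ_n²)·e^{−2δ_n}·exp{n(2R−I_P(X;X')−ε)}}. If the rate condition holds with parameter δ, then for all sufficiently large n, P[ℰ(P_{XX'})] ≤ (1−e^{−nε/2})^{−2}·[ e^{4δ_n}/((1−4δ_n²)²(1−e^{−nδ})²)·e^{−nε/2} + e^{4δ_n}/((1−4δ_n²)²(1−e^{−nδ})⁴) − 1 ]; in particular P[ℰ(P_{XX'})] → 0 as n → ∞. -/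

import Mathlib

open Filter Finset
open scoped Classical

noncomputable section

namespace RGV

/-- A probability distribution on a finite type. -/
def IsDist {α : Type} [Fintype α] (p : α → ℝ) : Prop :=
  (∀ a, 0 ≤ p a) ∧ ∑ a, p a = 1

/-- `p` is an `n`-type: all probabilities are integer multiples of `1/n`. -/
def IsTypeDist {α : Type} (n : ℕ) (p : α → ℝ) : Prop :=
  ∀ a, ∃ k : ℕ, p a * n = k

/-- Empirical distribution of a sequence. -/
def emp {α : Type} [Fintype α] (n : ℕ) (x : Fin n → α) : α → ℝ :=
  fun a => ((Finset.univ.filter fun i => x i = a).card : ℝ) / n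

/-- Joint empirical distribution of a pair of sequences. -/
def emp2 {α β : Type} [Fintype α] [Fintype β] (n : ℕ) (x : Fin n → α) (y : Fin n → β) :
    α × β → ℝ :=
  fun ab => ((Finset.univ.filter fun i => x i = ab.1 ∧ y i = ab.2).card : ℝ) / n

/-- The type class of a composition `Q`. -/
def typeClass {α : Type} [Fintype α] (n : ℕ) (Q : α → ℝ) : Finset (Fin n → α) :=
  Finset.univ.filter fun x => emp n x = Q

/-- The pair type class of a joint type `P`. -/
def typeClass2 {α : Type} [Fintype α] (n : ℕ) (P : α × α → ℝ) :
    Finset ((Fin n → α) × (Fin n → α)) :=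
  Finset.univ.filter fun xx => emp2 n xx.1 xx.2 = P

/-- `P` is a joint distribution on `α × α` with both marginals equal to `Q`. -/
def Joint {α : Type} [Fintype α] (Q : α → ℝ) (P : α × α → ℝ) : Prop :=
  IsDist P ∧ (∀ a, ∑ b, P (a, b) = Q a) ∧ (∀ b, ∑ a, P (a, b) = Q b)

/-- `d` is a distance function: continuous and symmetric. -/
def IsDistance {α : Type} [Fintype α] (d : (α × α → ℝ) → ℝ) : Prop :=
  Continuous d ∧ ∀ P : α × α → ℝ, d (fun p => P (p.2, p.1)) = d P

/-- Mutual information of a joint distribution (natural logarithms). -/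
def mutInf {α β : Type} [Fintype α] [Fintype β] (P : α × β → ℝ) : ℝ :=
  ∑ p : α × β, P p * Real.log (P p / ((∑ b, P (p.1, b)) * (∑ a, P (a, p.2))))

/-- Positive part `[t]₊`. -/
def pos (t : ℝ) : ℝ := max t 0

/-- Number of codewords at blocklength `n` and rate `R`. -/
def Mof (R : ℝ) (n : ℕ) : ℕ := ⌈Real.exp (n * R)⌉₊

/-- The feasible set for the `i`-th codeword given the previous ones. -/
def feasible {α : Type} [Fintype α] (n : ℕ) (Q : α → ℝ) (d : (α × α → ℝ) → ℝ) (Δ : ℝ)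
    {M : ℕ} (c : Fin M → Fin n → α) (i : Fin M) : Finset (Fin n → α) :=
  (typeClass n Q).filter fun z => ∀ j, j < i → Δ < d (emp2 n z (c j))

/-- The probability that the RGV construction outputs the codebook `c`. -/
def rgvProb {α : Type} [Fintype α] (n : ℕ) (Q : α → ℝ) (d : (α × α → ℝ) → ℝ) (Δ : ℝ)
    {M : ℕ} (c : Fin M → Fin n → α) : ℝ :=
  ∏ i : Fin M,
    if c i ∈ feasible n Q d Δ c i then ((feasible n Q d Δ c i).card : ℝ)⁻¹ else 0

/-- Expectation over the RGV ensemble. -/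
def expect {α : Type} [Fintype α] (n : ℕ) (Q : α → ℝ) (d : (α × α → ℝ) → ℝ) (Δ : ℝ)
    (M : ℕ) (f : (Fin M → Fin n → α) → ℝ) : ℝ :=
  ∑ c : Fin M → Fin n → α, rgvProb n Q d Δ c * f c

/-- Probability of an event over the RGV ensemble. -/
def prob {α : Type} [Fintype α] (n : ℕ) (Q : α → ℝ) (d : (α × α → ℝ) → ℝ) (Δ : ℝ)
    (M : ℕ) (S : (Fin M → Fin n → α) → Prop) : ℝ :=
  ∑ c : Fin M → Fin n → α, if S c then rgvProb n Q d Δ c else 0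

/-- `W` is a (discrete memoryless) channel. -/
def IsChannel {α β : Type} [Fintype β] (W : α → β → ℝ) : Prop := ∀ a, IsDist (W a)

/-- The product (memoryless) extension of the channel. -/
def Wn {α β : Type} (n : ℕ) (W : α → β → ℝ) (x : Fin n → α) (y : Fin n → β) : ℝ :=
  ∏ i, W (x i) (y i)

/-- GLD error probability of a codebook. -/
def Pe {α β : Type} [Fintype α] [Fintype β] (n : ℕ) (W : α → β → ℝ)
    (g : (α × β → ℝ) → ℝ) {M : ℕ} (c : Fin M → Fin n → α) : ℝ :=
  (M : ℝ)⁻¹ * ∑ m : Fin M, ∑ m' ∈ Finset.univ.erase m, ∑ y : Fin n → β,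
    Wn n W (c m) y * Real.exp ((n : ℝ) * g (emp2 n (c m') y)) /
      ∑ m'' : Fin M, Real.exp ((n : ℝ) * g (emp2 n (c m'') y))

/-- Marginal `P_{XY}` induced by `P_{XX'}` and the conditional law `V = P_{Y|XX'}`. -/
def PXY {α β : Type} [Fintype α] [Fintype β] (P : α × α → ℝ) (V : α × α → β → ℝ) :
    α × β → ℝ :=
  fun ay => ∑ b, P (ay.1, b) * V (ay.1, b) ay.2

/-- Marginal `P_{X'Y}`. -/
def PXpY {α β : Type} [Fintype α] [Fintype β] (P : α × α → ℝ) (V : α × α → β → ℝ) :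
    α × β → ℝ :=
  fun bY => ∑ a, P (a, bY.1) * V (a, bY.1) bY.2

/-- Output marginal `P_Y`. -/
def PYof {α β : Type} [Fintype α] [Fintype β] (P : α × α → ℝ) (V : α × α → β → ℝ) :
    β → ℝ :=
  fun y => ∑ p : α × α, P p * V p y

/-- Conditional divergence `D(P_{Y|X} ‖ W | Q)`. -/
def condDiv {α β : Type} [Fintype α] [Fintype β] (Q : α → ℝ) (W : α → β → ℝ)
    (P : α × α → ℝ) (V : α × α → β → ℝ) : ℝ :=
  ∑ a, ∑ y, PXY P V (a, y) * Real.log (PXY P V (a, y) / (Q a * W a y))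

/-- Conditional mutual information `I(X';Y|X)`. -/
def cmi {α β : Type} [Fintype α] [Fintype β] (P : α × α → ℝ) (V : α × α → β → ℝ) : ℝ :=
  ∑ a, ∑ b, ∑ y, P (a, b) * V (a, b) y *
    Real.log (P (a, b) * V (a, b) y * (∑ b', P (a, b')) /
      (P (a, b) * PXY P V (a, y)))

/-- The joint distribution on `α × β` induced by `P_Y` and a reverse channel `V'`. -/
def jointOf {α β : Type} (PY : β → ℝ) (V' : β → α → ℝ) : α × β → ℝ :=
  fun ay => PY ay.2 * V' ay.2 ay.1

/-- The quantity `α(R, P_Y)`. -/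
def alphaF {α β : Type} [Fintype α] [Fintype β] (Q : α → ℝ) (g : (α × β → ℝ) → ℝ)
    (R : ℝ) (PY : β → ℝ) : ℝ :=
  sSup { v | ∃ V' : β → α → ℝ, (∀ y, IsDist (V' y)) ∧
    (∀ a, ∑ y, PY y * V' y a = Q a) ∧ mutInf (jointOf PY V') ≤ R ∧
    v = g (jointOf PY V') - mutInf (jointOf PY V') } + R

/-- The exponent `Γ(P_{XX'}, R)`. -/
def Gamma {α β : Type} [Fintype α] [Fintype β] (Q : α → ℝ) (W : α → β → ℝ)
    (g : (α × β → ℝ) → ℝ) (P : α × α → ℝ) (R : ℝ) : ℝ :=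
  sInf { v | ∃ V : α × α → β → ℝ, (∀ p, IsDist (V p)) ∧
    v = condDiv Q W P V + cmi P V +
      pos (max (g (PXY P V)) (alphaF Q g R (PYof P V)) - g (PXpY P V)) }

/-- The quantity `β(R, P_Y)`. -/
def betaF {α β : Type} [Fintype α] [Fintype β] (Q : α → ℝ) (g : (α × β → ℝ) → ℝ)
    (R : ℝ) (PY : β → ℝ) : ℝ :=
  sSup { v | ∃ V' : β → α → ℝ, (∀ y, IsDist (V' y)) ∧
    (∀ a, ∑ y, PY y * V' y a = Q a) ∧
    v = g (jointOf PY V') + pos (R - mutInf (jointOf PY V')) }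

/-- The exponent `Λ(P_{XX'}, R)`. -/
def Lambda {α β : Type} [Fintype α] [Fintype β] (Q : α → ℝ) (W : α → β → ℝ)
    (g : (α × β → ℝ) → ℝ) (P : α × α → ℝ) (R : ℝ) : ℝ :=
  sInf { v | ∃ V : α × α → β → ℝ, (∀ p, IsDist (V p)) ∧
    v = condDiv Q W P V + cmi P V + betaF Q g R (PYof P V) - g (PXpY P V) }

/-- The candidate value of the typical random coding exponent of the RGV ensemble. -/
def EtrcVal {α β : Type} [Fintype α] [Fintype β] (Q : α → ℝ) (W : α → β → ℝ)
    (g : (α × β → ℝ) → ℝ) (d : (α × α → ℝ) → ℝ) (Δ R : ℝ) : ℝ :=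
  sInf { v | ∃ P : α × α → ℝ, Joint Q P ∧ mutInf P ≤ 2 * R ∧ Δ < d P ∧
    v = Gamma Q W g P R + mutInf P - R }

/-- The expurgated exponent. -/
def Eex {α β : Type} [Fintype α] [Fintype β] (Q : α → ℝ) (W : α → β → ℝ)
    (g : (α × β → ℝ) → ℝ) (R : ℝ) : ℝ :=
  sInf { v | ∃ P : α × α → ℝ, Joint Q P ∧ mutInf P ≤ R ∧
    v = Gamma Q W g P R + mutInf P - R }

/-- The expurgated exponent of the RGV ensemble. -/
def EexRgv {α β : Type} [Fintype α] [Fintype β] (Q : α → ℝ) (W : α → β → ℝ)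
    (g : (α × β → ℝ) → ℝ) (d : (α × α → ℝ) → ℝ) (Δ R : ℝ) : ℝ :=
  sInf { v | ∃ P : α × α → ℝ, Joint Q P ∧ Δ < d P ∧ mutInf P ≤ R ∧
    v = Gamma Q W g P R + mutInf P - R }

/-- The rate condition at blocklength `n` with parameter `δ`
(the minimum over an empty collection of joint types being `+∞`). -/
def RateCond {α : Type} [Fintype α] (n : ℕ) (Q : α → ℝ) (d : (α × α → ℝ) → ℝ)
    (Δ R δ : ℝ) : Prop :=
  ((R : ℝ) : EReal) ≤
    sInf { v : EReal | ∃ P : α × α → ℝ, Joint Q P ∧ IsTypeDist n P ∧ d P ≤ Δ ∧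
      v = ((mutInf P : ℝ) : EReal) } - (((2 * δ : ℝ)) : EReal)

/-- Type enumerator: the number of ordered pairs of distinct codewords
with joint empirical distribution `P`. -/
def Nenum {α : Type} [Fintype α] (n : ℕ) (P : α × α → ℝ) {M : ℕ}
    (c : Fin M → Fin n → α) : ℕ :=
  ((Finset.univ : Finset (Fin M × Fin M)).filter fun mm =>
    mm.1 ≠ mm.2 ∧ emp2 n (c mm.1) (c mm.2) = P).card

/-- Normalized log of a probability (exponential rate), valued in `EReal`. -/
def lrate (n : ℕ) (p : ℝ) : EReal :=
  if p ≤ 0 then ⊥ else ((Real.log p / n : ℝ) : EReal)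

/-- Normalized iterated-log rate (double-exponential decay rate), valued in `EReal`. -/
def drate (n : ℕ) (p : ℝ) : EReal :=
  if p ≤ 0 then ⊤ else if 1 ≤ p then ⊥
  else ((Real.log (-Real.log p) / n : ℝ) : EReal)

/-- `δ_n = e^{-nδ}/(1-e^{-nδ})`. -/
def deltan (n : ℕ) (δ : ℝ) : ℝ := Real.exp (-(n * δ)) / (1 - Real.exp (-(n * δ)))

/-- Blocklength sequence: the multiples of the denominator `D` of the composition. -/
def nseq (D t : ℕ) : ℕ := D * (t + 1)

/-- The normalized expected log error probability `-(1/n) E[log P_e(C_n)]`. -/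
def Expnt {α β : Type} [Fintype α] [Fintype β] (n : ℕ) (Q : α → ℝ)
    (d : (α × α → ℝ) → ℝ) (Δ : ℝ) (W : α → β → ℝ) (g : (α × β → ℝ) → ℝ) (R : ℝ) : ℝ :=
  -(expect n Q d Δ (Mof R n) (fun c => Real.log (Pe n W g c)) / n)

/-- Ratio of type class sizes `|T(P)| / |T(Q)|²`. -/
def Lsize {α : Type} [Fintype α] (n : ℕ) (Q : α → ℝ) (P : α × α → ℝ) : ℝ :=
  ((typeClass2 n P).card : ℝ) / ((typeClass n Q).card : ℝ) ^ 2

end RGV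

namespace RGV

/-- Two sequences with the same letter counts differ by a permutation of the coordinates. -/
lemma exists_perm_comp_eq {ι β : Type} [Fintype ι] {x y : ι → β}
    (h : ∀ b, #{i | x i = b} = #{i | y i = b}) : ∃ σ : Equiv.Perm ι, x ∘ σ = y := by
  have e : ∀ b, Nonempty ({i // y i = b} ≃ {i // x i = b}) := fun b => by
    rw [← Fintype.card_eq, Fintype.card_subtype, Fintype.card_subtype, h b]
  refine ⟨((Equiv.sigmaFiberEquiv y).symm.trans
    (Equiv.sigmaCongrRight fun b => (e b).some)).trans (Equiv.sigmaFiberEquiv x), ?_⟩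
  funext i
  exact ((e (y i)).some ⟨i, rfl⟩).2

/-- Every count vector summing to `n` is realised by a sequence. -/
lemma exists_counts_eq {β : Type} [Fintype β] {n : ℕ} {k : β → ℕ} (hk : ∑ b, k b = n) :
    ∃ x : Fin n → β, ∀ b, #{i | x i = b} = k b := by
  have e : Nonempty (Fin n ≃ Σ b, Fin (k b)) := by
    rw [← Fintype.card_eq]; simp [hk]
  refine ⟨fun i => (e.some i).1, fun b => ?_⟩
  rw [← Fintype.card_subtype,
    Fintype.card_congr (e.some.subtypeEquiv (q := fun s => s.1 = b) fun i => Iff.rfl),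
    Fintype.card_congr (Equiv.sigmaSubtype b), Fintype.card_fin]

/-- The number of sequences with prescribed letter counts is a multinomial coefficient. -/
lemma card_counts_eq_multinomial {β : Type} [Fintype β] {n : ℕ} {k : β → ℕ}
    (hk : ∑ b, k b = n) :
    #{x : Fin n → β | ∀ b, #{i | x i = b} = k b} = Nat.multinomial univ k := by
  obtain ⟨x, hx⟩ := exists_counts_eq hk
  have hstab : #{σ : Equiv.Perm (Fin n) | x ∘ σ = x} = ∏ b, (k b).factorial := by
    rw [← Fintype.card_subtype, DomMulAct.stabilizer_card]
    simp only [Fintype.card_subtype, hx]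
  have hfib : ∀ y ∈ ({x : Fin n → β | ∀ b, #{i | x i = b} = k b} : Finset _),
      #{σ : Equiv.Perm (Fin n) | x ∘ σ = y} = ∏ b, (k b).factorial := by
    intro y hy
    rw [mem_filter] at hy
    obtain ⟨τ, rfl⟩ := exists_perm_comp_eq (x := x) (y := y) (fun b => by rw [hx, hy.2])
    rw [← hstab]
    refine card_equiv (Equiv.mulRight τ⁻¹) fun σ => ?_
    simp only [mem_filter_univ, Equiv.coe_mulRight, Equiv.Perm.coe_mul, ← Function.comp_assoc]
    constructor
    · intro h
      rw [h, Function.comp_assoc, ← Equiv.Perm.coe_mul]; simp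
    · intro h
      conv_rhs => rw [← h]
      rw [Function.comp_assoc, ← Equiv.Perm.coe_mul]; simp
  have hmaps : ∀ σ ∈ (univ : Finset (Equiv.Perm (Fin n))),
      x ∘ σ ∈ ({x : Fin n → β | ∀ b, #{i | x i = b} = k b} : Finset _) := by
    intro σ _
    rw [mem_filter_univ]
    intro b
    rw [← hx b]
    exact card_equiv σ (fun i => by simp)
  have := card_eq_sum_card_fiberwise hmaps
  rw [sum_congr rfl hfib, sum_const, card_univ, Fintype.card_perm, Fintype.card_fin,
    smul_eq_mul] at this
  have h2 := Nat.multinomial_spec univ k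
  rw [hk, this, mul_comm] at h2
  exact (Nat.eq_of_mul_eq_mul_right (Finset.prod_pos fun b _ => Nat.factorial_pos _) h2).symm

lemma factorial_mul_pow_le (k l : ℕ) : k.factorial * k ^ l ≤ l.factorial * k ^ k := by
  rcases le_total k l with h | h
  · have := Nat.factorial_mul_pow_sub_le_factorial h
    calc k.factorial * k ^ l = k.factorial * k ^ (l - k) * k ^ k := by
          rw [mul_assoc, ← pow_add, Nat.sub_add_cancel h]
      _ ≤ _ := Nat.mul_le_mul_right _ this
  · have h1 := Nat.factorial_mul_descFactorial (Nat.sub_le k l)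
    rw [Nat.sub_sub_self h] at h1
    have h2 := Nat.descFactorial_le_pow k (k - l)
    calc k.factorial * k ^ l = l.factorial * (k.descFactorial (k - l) * k ^ l) := by
          rw [← h1, mul_assoc]
      _ ≤ l.factorial * (k ^ (k - l) * k ^ l) := by gcongr
      _ = _ := by rw [← pow_add, Nat.sub_add_cancel h]

lemma multinomial_mul_prod_pow_le {β : Type} [Fintype β] {n : ℕ} {k l : β → ℕ}
    (hk : ∑ b, k b = n) (hl : ∑ b, l b = n) :
    Nat.multinomial univ l * ∏ b, k b ^ l b ≤ Nat.multinomial univ k * ∏ b, k b ^ k b := by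
  have h1 := Nat.multinomial_spec univ k
  have h2 := Nat.multinomial_spec univ l
  rw [hk] at h1
  rw [hl] at h2
  have h3 : (∏ b, (k b).factorial) * ∏ b, k b ^ l b ≤ (∏ b, (l b).factorial) * ∏ b, k b ^ k b := by
    rw [← prod_mul_distrib, ← prod_mul_distrib]
    exact prod_le_prod' fun b _ => factorial_mul_pow_le _ _
  have p1 : 0 < ∏ b, (k b).factorial := Finset.prod_pos fun b _ => Nat.factorial_pos _
  have p2 : 0 < ∏ b, (l b).factorial := Finset.prod_pos fun b _ => Nat.factorial_pos _
  refine Nat.le_of_mul_le_mul_left ?_ (Nat.mul_pos p1 p2)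
  calc _ = ((∏ b, (l b).factorial) * Nat.multinomial univ l) *
        ((∏ b, (k b).factorial) * ∏ b, k b ^ l b) := by ring
    _ ≤ ((∏ b, (l b).factorial) * Nat.multinomial univ l) *
        ((∏ b, (l b).factorial) * ∏ b, k b ^ k b) := Nat.mul_le_mul_left _ h3
    _ = ((∏ b, (k b).factorial) * Nat.multinomial univ k) *
        ((∏ b, (l b).factorial) * ∏ b, k b ^ k b) := by rw [h1, h2]
    _ = _ := by ring

lemma card_piAntidiag_univ_le (β : Type) [Fintype β] (n : ℕ) :
    #((univ : Finset β).piAntidiag n) ≤ (n + 1) ^ Fintype.card β := by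
  calc #((univ : Finset β).piAntidiag n) ≤ #(Fintype.piFinset fun _ : β => range (n + 1)) := by
        refine card_le_card fun f hf => ?_
        rw [Fintype.mem_piFinset]
        intro b
        rw [mem_piAntidiag] at hf
        rw [mem_range, Nat.lt_succ_iff, ← hf.1]
        exact single_le_sum (fun _ _ => Nat.zero_le _) (mem_univ b)
    _ = _ := by simp

/-- The multinomial coefficient is at most its entropy estimate. -/
lemma multinomial_mul_prod_le {β : Type} [Fintype β] {n : ℕ} {k : β → ℕ}
    (hk : ∑ b, k b = n) :
    Nat.multinomial univ k * ∏ b, k b ^ k b ≤ n ^ n := by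
  have h := sum_pow_eq_sum_piAntidiag univ k n
  rw [hk] at h
  rw [h]
  exact single_le_sum (f := fun l => Nat.multinomial univ l * ∏ b, k b ^ l b)
    (fun _ _ => Nat.zero_le _) (by simp [hk])

/-- The multinomial coefficient is at least its entropy estimate up to a polynomial. -/
lemma le_multinomial_mul_prod {β : Type} [Fintype β] {n : ℕ} {k : β → ℕ}
    (hk : ∑ b, k b = n) :
    n ^ n ≤ (n + 1) ^ Fintype.card β * (Nat.multinomial univ k * ∏ b, k b ^ k b) := by
  have h := sum_pow_eq_sum_piAntidiag univ k n
  rw [hk] at h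
  rw [h]
  refine (sum_le_card_nsmul _ _ (Nat.multinomial univ k * ∏ b, k b ^ k b) fun l hl => ?_).trans ?_
  · rw [mem_piAntidiag] at hl
    exact multinomial_mul_prod_pow_le hk hl.1
  · rw [smul_eq_mul]
    exact Nat.mul_le_mul_right _ (card_piAntidiag_univ_le β n)

lemma typeClass_eq_counts {β : Type} [Fintype β] {n : ℕ} (hn : 0 < n) {p : β → ℝ} {k : β → ℕ}
    (hk : ∀ b, p b * n = k b) :
    typeClass n p = ({x : Fin n → β | ∀ b, #{i | x i = b} = k b} : Finset _) := by
  have hn' : (n : ℝ) ≠ 0 := by positivity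
  ext x
  simp only [typeClass, mem_filter_univ, funext_iff, emp]
  refine forall_congr' fun b => ?_
  rw [div_eq_iff hn', hk b, Nat.cast_inj]

lemma sum_counts_eq {β : Type} [Fintype β] {n : ℕ} {p : β → ℝ} (hp : IsDist p) {k : β → ℕ}
    (hk : ∀ b, p b * n = k b) : ∑ b, k b = n := by
  have : ((∑ b, k b : ℕ) : ℝ) = n := by
    push_cast
    rw [← sum_congr rfl fun b _ => hk b, ← sum_mul, hp.2, one_mul]
  exact_mod_cast this

lemma prod_counts_pow_eq {β : Type} [Fintype β] {n : ℕ} {p : β → ℝ}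
    (hp : IsDist p) {k : β → ℕ} (hk : ∀ b, p b * n = k b) :
    ∏ b, (k b : ℝ) ^ k b = (n : ℝ) ^ n * Real.exp (n * ∑ b, p b * Real.log (p b)) := by
  have h : ∀ b, (k b : ℝ) ^ k b = (n : ℝ) ^ k b * Real.exp (n * (p b * Real.log (p b))) := by
    intro b
    rcases (hp.1 b).eq_or_lt with h0 | h0
    · have : k b = 0 := by
        have := hk b
        rw [← h0, zero_mul] at this
        exact_mod_cast this.symm
      simp [this, ← h0]
    · have : Real.exp (n * (p b * Real.log (p b))) = p b ^ k b := by
        rw [← mul_assoc, mul_comm (n : ℝ), hk b, mul_comm, ← Real.rpow_natCast,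
          Real.rpow_def_of_pos h0]
      rw [this, ← mul_pow, mul_comm (n : ℝ), hk b]
  rw [prod_congr rfl fun b _ => h b, prod_mul_distrib, ← Real.exp_sum, prod_pow_eq_pow_sum,
    sum_counts_eq hp hk, mul_sum]

lemma card_typeClass_mul_exp_le {β : Type} [Fintype β] {n : ℕ} (hn : 0 < n) {p : β → ℝ}
    (hp : IsDist p) (hpn : IsTypeDist n p) :
    (#(typeClass n p) : ℝ) * Real.exp (n * ∑ b, p b * Real.log (p b)) ≤ 1 := by
  choose k hk using hpn
  have h := multinomial_mul_prod_le (sum_counts_eq hp hk)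
  rw [← card_counts_eq_multinomial (sum_counts_eq hp hk), ← typeClass_eq_counts hn hk] at h
  have h' : (#(typeClass n p) : ℝ) * ∏ b, (k b : ℝ) ^ k b ≤ (n : ℝ) ^ n := by exact_mod_cast h
  rw [prod_counts_pow_eq hp hk] at h'
  have : 0 < (n : ℝ) ^ n := by positivity
  nlinarith

lemma one_le_card_typeClass_mul_exp {β : Type} [Fintype β] {n : ℕ} (hn : 0 < n) {p : β → ℝ}
    (hp : IsDist p) (hpn : IsTypeDist n p) :
    1 ≤ ((n : ℝ) + 1) ^ Fintype.card β *
      ((#(typeClass n p) : ℝ) * Real.exp (n * ∑ b, p b * Real.log (p b))) := by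
  choose k hk using hpn
  have h := le_multinomial_mul_prod (sum_counts_eq hp hk)
  rw [← card_counts_eq_multinomial (sum_counts_eq hp hk), ← typeClass_eq_counts hn hk] at h
  have h' : (n : ℝ) ^ n ≤ ((n : ℝ) + 1) ^ Fintype.card β *
      ((#(typeClass n p) : ℝ) * ∏ b, (k b : ℝ) ^ k b) := by exact_mod_cast h
  rw [prod_counts_pow_eq hp hk] at h'
  have : 0 < (n : ℝ) ^ n := by positivity
  refine le_of_mul_le_mul_left ?_ this
  linarith

lemma card_typeClass2 {α : Type} [Fintype α] (n : ℕ) (P : α × α → ℝ) :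
    #(typeClass2 n P) = #(typeClass n P) := by
  refine (card_equiv (Equiv.arrowProdEquivProdArrow (Fin n) (fun _ => α) (fun _ => α)) fun x => ?_).symm
  simp [typeClass, typeClass2, funext_iff, emp, emp2, Prod.ext_iff,
    Equiv.arrowProdEquivProdArrow]

lemma Joint.isDist {α : Type} [Fintype α] {Q : α → ℝ} {P : α × α → ℝ} (h : Joint Q P) :
    IsDist Q := by
  refine ⟨fun a => ?_, ?_⟩
  · rw [← h.2.1 a]
    exact sum_nonneg fun b _ => h.1.1 _
  · rw [← h.1.2, Fintype.sum_prod_type]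
    exact sum_congr rfl fun a _ => (h.2.1 a).symm

lemma Joint.isTypeDist {α : Type} [Fintype α] {Q : α → ℝ} {P : α × α → ℝ} (h : Joint Q P)
    {n : ℕ} (hn : IsTypeDist n P) : IsTypeDist n Q := by
  intro a
  choose k hk using hn
  refine ⟨∑ b, k (a, b), ?_⟩
  rw [← h.2.1 a, sum_mul]
  push_cast
  exact sum_congr rfl fun b _ => hk _

lemma Joint.mutInf_eq {α : Type} [Fintype α] {Q : α → ℝ} {P : α × α → ℝ} (h : Joint Q P) :
    mutInf P = ∑ p, P p * Real.log (P p) - 2 * ∑ a, Q a * Real.log (Q a) := by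
  have h1 : ∀ p : α × α, P p * Real.log (P p / ((∑ b, P (p.1, b)) * (∑ a, P (a, p.2)))) =
      P p * Real.log (P p) - P p * Real.log (Q p.1) - P p * Real.log (Q p.2) := by
    rintro ⟨a, b⟩
    rw [h.2.1, h.2.2]
    rcases (h.1.1 (a, b)).eq_or_lt with h0 | h0
    · simp [← h0]
    · have ha : 0 < Q a := by
        rw [← h.2.1 a]
        exact h0.trans_le (single_le_sum (f := fun b => P (a, b)) (fun b _ => h.1.1 _) (mem_univ b))
      have hb : 0 < Q b := by
        rw [← h.2.2 b]
        exact h0.trans_le (single_le_sum (f := fun a => P (a, b)) (fun b _ => h.1.1 _) (mem_univ a))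
      rw [Real.log_div h0.ne' (by positivity), Real.log_mul ha.ne' hb.ne']
      ring
  have h2 : ∑ p : α × α, P p * Real.log (Q p.1) = ∑ a, Q a * Real.log (Q a) := by
    rw [Fintype.sum_prod_type]
    exact sum_congr rfl fun a _ => by
      simp only [← sum_mul, h.2.1]
  have h3 : ∑ p : α × α, P p * Real.log (Q p.2) = ∑ a, Q a * Real.log (Q a) := by
    rw [Fintype.sum_prod_type_right]
    exact sum_congr rfl fun a _ => by
      simp only [← sum_mul, h.2.2]
  rw [mutInf, sum_congr rfl fun p _ => h1 p, sum_sub_distrib, sum_sub_distrib, h2, h3]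
  ring

lemma card_typeClass_pos {β : Type} [Fintype β] {n : ℕ} (hn : 0 < n) {p : β → ℝ}
    (hp : IsDist p) (hpn : IsTypeDist n p) : 0 < #(typeClass n p) := by
  choose k hk using hpn
  rw [typeClass_eq_counts hn hk, card_counts_eq_multinomial (sum_counts_eq hp hk)]
  exact Nat.multinomial_pos _ _

lemma Joint.card_typeClass2_le {α : Type} [Fintype α] {Q : α → ℝ} {P : α × α → ℝ}
    (h : Joint Q P) {n : ℕ} (hn : 0 < n) (hPn : IsTypeDist n P) :
    (#(typeClass2 n P) : ℝ) ≤ ((n : ℝ) + 1) ^ (2 * Fintype.card α) *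
      Real.exp (-(n * mutInf P)) * (#(typeClass n Q) : ℝ) ^ 2 := by
  have h1 := card_typeClass_mul_exp_le hn h.1 hPn
  have h2 := one_le_card_typeClass_mul_exp hn h.isDist (h.isTypeDist hPn)
  rw [← card_typeClass2] at h1
  rw [h.mutInf_eq]
  set s := ∑ p, P p * Real.log (P p)
  set q := ∑ a, Q a * Real.log (Q a)
  have e : Real.exp (-(n * (s - 2 * q))) = Real.exp (n * q) ^ 2 / Real.exp (n * s) := by
    rw [← Real.exp_nat_mul, ← Real.exp_sub]; congr 1; push_cast; ring
  have h3 : 1 ≤ (((n : ℝ) + 1) ^ Fintype.card α *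
      ((#(typeClass n Q) : ℝ) * Real.exp (n * q))) ^ 2 := one_le_pow₀ h2
  rw [← le_div_iff₀ (Real.exp_pos _)] at h1
  refine h1.trans ?_
  calc 1 / Real.exp (n * s) ≤ (((n : ℝ) + 1) ^ Fintype.card α *
      ((#(typeClass n Q) : ℝ) * Real.exp (n * q))) ^ 2 / Real.exp (n * s) := by gcongr
    _ = _ := by rw [e, pow_mul']; ring

lemma Joint.exp_mul_le_card_typeClass2 {α : Type} [Fintype α] {Q : α → ℝ} {P : α × α → ℝ}
    (h : Joint Q P) {n : ℕ} (hn : 0 < n) (hPn : IsTypeDist n P) :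
    Real.exp (-(n * mutInf P)) * (#(typeClass n Q) : ℝ) ^ 2 ≤
      ((n : ℝ) + 1) ^ Fintype.card (α × α) * (#(typeClass2 n P) : ℝ) := by
  have h1 := card_typeClass_mul_exp_le hn h.isDist (h.isTypeDist hPn)
  have h2 := one_le_card_typeClass_mul_exp hn h.1 hPn
  rw [← card_typeClass2] at h2
  rw [h.mutInf_eq]
  set s := ∑ p, P p * Real.log (P p)
  set q := ∑ a, Q a * Real.log (Q a)
  have e : Real.exp (-(n * (s - 2 * q))) = Real.exp (n * q) ^ 2 / Real.exp (n * s) := by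
    rw [← Real.exp_nat_mul, ← Real.exp_sub]; congr 1; push_cast; ring
  have h3 : ((#(typeClass n Q) : ℝ) * Real.exp (n * q)) ^ 2 ≤ 1 :=
    pow_le_one₀ (by positivity) h1
  rw [e, div_mul_eq_mul_div, div_le_iff₀ (Real.exp_pos _)]
  calc _ = ((#(typeClass n Q) : ℝ) * Real.exp (n * q)) ^ 2 := by ring
    _ ≤ 1 := h3
    _ ≤ _ := h2
    _ = _ := by ring

lemma sum_emp2_right {α : Type} [Fintype α] (n : ℕ) (x y : Fin n → α) (a : α) :
    ∑ b, emp2 n x y (a, b) = emp n x a := by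
  simp only [emp2, emp]
  rw [← sum_div, ← Nat.cast_sum]
  congr 2
  rw [card_eq_sum_card_fiberwise (f := y) (t := univ) (by simp)]
  simp [filter_filter]

lemma emp2_swap {α : Type} [Fintype α] (n : ℕ) (x y : Fin n → α) (p : α × α) :
    emp2 n x y p = emp2 n y x p.swap := by
  simp [emp2, and_comm]

lemma sum_emp2_left {α : Type} [Fintype α] (n : ℕ) (x y : Fin n → α) (b : α) :
    ∑ a, emp2 n x y (a, b) = emp n y b := by
  rw [← sum_emp2_right n y x b]
  exact sum_congr rfl fun a _ => emp2_swap n x y (a, b)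

lemma isTypeDist_emp2 {α : Type} [Fintype α] {n : ℕ} (hn : 0 < n) (x y : Fin n → α) :
    IsTypeDist n (emp2 n x y) := fun p =>
  ⟨_, div_mul_cancel₀ _ (by positivity)⟩

lemma isDist_emp {α : Type} [Fintype α] {n : ℕ} (hn : 0 < n) (x : Fin n → α) :
    IsDist (emp n x) := by
  refine ⟨fun a => by unfold emp; positivity, ?_⟩
  simp only [emp]
  rw [← sum_div, ← Nat.cast_sum, ← card_eq_sum_card_fiberwise (f := x) (t := univ) (by simp)]
  simp [hn.ne']

lemma joint_emp2 {α : Type} [Fintype α] {n : ℕ} (hn : 0 < n) {Q : α → ℝ} {x y : Fin n → α}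
    (hx : x ∈ typeClass n Q) (hy : y ∈ typeClass n Q) : Joint Q (emp2 n x y) := by
  rw [typeClass, mem_filter_univ] at hx hy
  refine ⟨⟨fun p => by unfold emp2; positivity, ?_⟩, ?_, ?_⟩
  · rw [Fintype.sum_prod_type, ← (isDist_emp hn x).2]
    exact sum_congr rfl fun a _ => sum_emp2_right n x y a
  · intro a
    rw [sum_emp2_right, hx]
  · intro a
    rw [sum_emp2_left, hy]

lemma Joint.mem_typeClass {α : Type} [Fintype α] {Q : α → ℝ} {P : α × α → ℝ} (h : Joint Q P)
    {n : ℕ} {x y : Fin n → α} (hxy : emp2 n x y = P) : x ∈ typeClass n Q ∧ y ∈ typeClass n Q := by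
  simp only [typeClass, mem_filter_univ]
  subst hxy
  exact ⟨funext fun a => by rw [← sum_emp2_right n x y, h.2.1],
    funext fun a => by rw [← sum_emp2_left n x y, h.2.2]⟩

lemma emp2_comp_perm {α : Type} [Fintype α] {n : ℕ} (x y : Fin n → α)
    (σ : Equiv.Perm (Fin n)) : emp2 n (x ∘ σ) (y ∘ σ) = emp2 n x y := by
  funext p
  simp only [emp2]
  congr 2
  exact card_equiv σ fun i => by simp

/-- All sequences of a type class have equally many partners of a given joint type. -/
lemma Joint.card_typeClass2_eq {α : Type} [Fintype α] {Q : α → ℝ} {P : α × α → ℝ}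
    (h : Joint Q P) {n : ℕ} (hn : 0 < n) {x : Fin n → α} (hx : x ∈ typeClass n Q) :
    #(typeClass2 n P) = #(typeClass n Q) * #{y | emp2 n x y = P} := by
  have hmaps : ∀ p ∈ typeClass2 n P, p.1 ∈ typeClass n Q := fun p hp => by
    rw [typeClass2, mem_filter_univ] at hp
    exact (h.mem_typeClass hp).1
  rw [card_eq_sum_card_fiberwise hmaps, ← smul_eq_mul, ← sum_const]
  refine sum_congr rfl fun z hz => ?_
  have hn' : (n : ℝ) ≠ 0 := by positivity
  obtain ⟨σ, rfl⟩ := exists_perm_comp_eq (x := x) (y := z) fun b => by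
    rw [typeClass, mem_filter_univ] at hx hz
    have := congrFun (hx.trans hz.symm) b
    simp only [emp] at this
    rw [div_left_inj' hn'] at this
    exact_mod_cast this
  symm
  refine card_bij (fun y _ => (x ∘ σ, y ∘ σ)) ?_ ?_ ?_
  · intro y hy
    rw [mem_filter_univ] at hy
    simp [typeClass2, emp2_comp_perm, hy]
  · intro y _ y' _ hyy
    exact (Equiv.surjective σ).injective_comp_right (Prod.ext_iff.1 hyy).2
  · rintro ⟨u, v⟩ hu
    simp only [typeClass2, mem_filter, mem_univ, true_and] at hu
    obtain ⟨hu, rfl⟩ := hu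
    refine ⟨v ∘ σ.symm, ?_, ?_⟩
    · rw [mem_filter_univ, ← hu, ← emp2_comp_perm _ _ σ]
      simp [Function.comp_assoc]
    · simp [Function.comp_assoc]

lemma Joint.swap {α : Type} [Fintype α] {Q : α → ℝ} {P : α × α → ℝ} (h : Joint Q P) :
    Joint Q (fun p => P p.swap) := by
  refine ⟨⟨fun p => h.1.1 _, ?_⟩, h.2.2, h.2.1⟩
  rw [← h.1.2]
  exact (Equiv.prodComm α α).sum_comp P

lemma emp2_eq_swap_iff {α : Type} [Fintype α] {n : ℕ} {P : α × α → ℝ} (x y : Fin n → α) :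
    emp2 n x y = (fun p => P p.swap) ↔ emp2 n y x = P := by
  constructor
  · intro h
    funext p
    rw [emp2_swap, h]
    simp only [Prod.swap_swap]
  · rintro rfl
    funext p
    rw [emp2_swap]

lemma Joint.card_typeClass2_eq' {α : Type} [Fintype α] {Q : α → ℝ} {P : α × α → ℝ}
    (h : Joint Q P) {n : ℕ} (hn : 0 < n) {x : Fin n → α} (hx : x ∈ typeClass n Q) :
    #(typeClass2 n P) = #(typeClass n Q) * #{y | emp2 n y x = P} := by
  have h1 := h.swap.card_typeClass2_eq hn hx
  simp only [emp2_eq_swap_iff] at h1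
  rw [← h1]
  refine card_equiv (Equiv.prodComm _ _) fun p => ?_
  simp only [typeClass2, mem_filter_univ, emp2_eq_swap_iff]
  simp

/-- Under the rate condition, few sequences lie within distance `Δ` of a given one. -/
lemma card_ball_le {α : Type} [Fintype α] {Q : α → ℝ} {n : ℕ} (hn : 0 < n)
    {d : (α × α → ℝ) → ℝ} {Δ R δ : ℝ} (hrate : RateCond n Q d Δ R δ) {x : Fin n → α}
    (hx : x ∈ typeClass n Q) :
    (#{z ∈ typeClass n Q | ¬ Δ < d (emp2 n z x)} : ℝ) ≤
      ((n : ℝ) + 1) ^ (Fintype.card (α × α) + 2 * Fintype.card α) *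
        Real.exp (-(n * (R + 2 * δ))) * #(typeClass n Q) := by
  set B := ({z ∈ typeClass n Q | ¬ Δ < d (emp2 n z x)} : Finset _) with hB
  have hT : 0 < #(typeClass n Q) := card_pos.2 ⟨x, hx⟩
  have hI : ∀ z ∈ B, R + 2 * δ ≤ mutInf (emp2 n z x) := by
    intro z hz
    rw [hB, mem_filter, not_lt] at hz
    have h1 : sInf { v : EReal | ∃ P : α × α → ℝ, Joint Q P ∧ IsTypeDist n P ∧ d P ≤ Δ ∧
      v = ((mutInf P : ℝ) : EReal) } ≤ (mutInf (emp2 n z x) : ℝ) :=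
      sInf_le ⟨_, joint_emp2 hn hz.1 hx, isTypeDist_emp2 hn _ _, hz.2, rfl⟩
    have h2 := le_trans hrate (EReal.sub_le_sub h1 le_rfl)
    rw [← EReal.coe_sub, EReal.coe_le_coe_iff] at h2
    linarith
  have himg : #(B.image fun z => emp2 n z x) ≤ (n + 1) ^ Fintype.card (α × α) := by
    have : B.image (fun z => emp2 n z x) ⊆
        (Fintype.piFinset fun _ : α × α => range (n + 1)).image
          fun (k : α × α → ℕ) p => (k p : ℝ) / n := by
      intro P hP
      obtain ⟨z, _, rfl⟩ := mem_image.1 hP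
      refine mem_image.2 ⟨fun ab => #{i | z i = ab.1 ∧ x i = ab.2}, ?_, rfl⟩
      rw [Fintype.mem_piFinset]
      intro p
      rw [mem_range, Nat.lt_succ_iff]
      exact (card_le_univ _).trans (by simp)
    refine ((card_le_card this).trans card_image_le).trans ?_
    simp
  have hfib : ∀ P ∈ B.image (fun z => emp2 n z x), (#{z ∈ B | emp2 n z x = P} : ℝ) ≤
      ((n : ℝ) + 1) ^ (2 * Fintype.card α) * Real.exp (-(n * (R + 2 * δ))) *
        #(typeClass n Q) := by
    intro P hP
    obtain ⟨z, hz, rfl⟩ := mem_image.1 hP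
    have hzQ := (mem_filter.1 hz).1
    have hJ := joint_emp2 hn hzQ hx
    have h1 := hJ.card_typeClass2_le hn (isTypeDist_emp2 hn _ _)
    rw [hJ.card_typeClass2_eq' hn hx] at h1
    push_cast at h1
    have h2 : (#{y | emp2 n y x = emp2 n z x} : ℝ) ≤ ((n : ℝ) + 1) ^ (2 * Fintype.card α) *
      Real.exp (-(n * mutInf (emp2 n z x))) * (#(typeClass n Q) : ℝ) := by
      refine le_of_mul_le_mul_left (h1.trans_eq ?_) (Nat.cast_pos.2 hT)
      ring
    have h3 : (#{y ∈ B | emp2 n y x = emp2 n z x} : ℝ) ≤ #{y | emp2 n y x = emp2 n z x} := by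
      exact_mod_cast card_le_card (filter_subset_filter _ (subset_univ _))
    refine h3.trans (h2.trans ?_)
    gcongr
    exact hI z hz
  have h4 := card_eq_sum_card_fiberwise (s := B) (f := fun z => emp2 n z x)
    (t := B.image fun z => emp2 n z x) (fun z hz => mem_image_of_mem _ hz)
  rw [h4]
  push_cast
  refine (sum_le_card_nsmul _ _ _ hfib).trans ?_
  rw [nsmul_eq_mul, pow_add]
  have h5 : (#(B.image fun z => emp2 n z x) : ℝ) ≤ ((n : ℝ) + 1) ^ Fintype.card (α × α) := by
    exact_mod_cast himg
  calc _ ≤ ((n : ℝ) + 1) ^ Fintype.card (α × α) * (((n : ℝ) + 1) ^ (2 * Fintype.card α) *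
        Real.exp (-(n * (R + 2 * δ))) * #(typeClass n Q)) := by gcongr
    _ = _ := by ring

lemma sum_piFinset_snoc {A : Type} [Fintype A] {M : ℕ} (S : Fin (M + 1) → Finset A)
    (f : (Fin (M + 1) → A) → ℝ) :
    ∑ c ∈ Fintype.piFinset S, f c =
      ∑ c ∈ Fintype.piFinset fun i : Fin M => S i.castSucc, ∑ z ∈ S (Fin.last M),
        f (Fin.snoc (α := fun _ => A) c z) := by
  rw [← sum_product']
  refine sum_nbij' (fun c => (Fin.init c, c (Fin.last M)))
    (fun p => Fin.snoc (α := fun _ => A) p.1 p.2) ?_ ?_ ?_ ?_ ?_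
  · intro c hc
    rw [Fintype.mem_piFinset] at hc
    rw [mem_product, Fintype.mem_piFinset]
    exact ⟨fun i => hc i.castSucc, hc _⟩
  · rintro ⟨c, z⟩ hc
    rw [mem_product, Fintype.mem_piFinset] at hc
    rw [Fintype.mem_piFinset]
    intro i
    refine Fin.lastCases ?_ (fun j => ?_) i
    · simpa using hc.2
    · simpa using hc.1 j
  · intro c _
    simp
  · intro p _
    simp
  · intro c _
    simp

/-- Peeling off the last draw of a sequential sampling scheme. -/
lemma sum_piFinset_sequential_succ {A : Type} [Fintype A] {M : ℕ}
    (q : (Fin (M + 1) → A) → Fin (M + 1) → A → ℝ)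
    (hq : ∀ c c' i, (∀ j < i, c j = c' j) → q c i = q c' i) (S : Fin (M + 1) → Finset A) (z₀ : A) :
    ∑ c ∈ Fintype.piFinset S, ∏ i, q c i (c i) =
      ∑ c ∈ Fintype.piFinset fun i : Fin M => S i.castSucc,
        (∏ i, q (Fin.snoc (α := fun _ => A) c z₀) i.castSucc (c i)) *
          ∑ z ∈ S (Fin.last M), q (Fin.snoc (α := fun _ => A) c z₀) (Fin.last M) z := by
  rw [sum_piFinset_snoc]
  refine sum_congr rfl fun c _ => ?_
  rw [mul_sum]
  refine sum_congr rfl fun z _ => ?_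
  rw [Fin.prod_univ_castSucc]
  have hagree : ∀ i : Fin (M + 1), ∀ j < i, (Fin.snoc (α := fun _ => A) c z : Fin (M + 1) → A) j =
      (Fin.snoc (α := fun _ => A) c z₀ : Fin (M + 1) → A) j := by
    intro i j hj
    obtain ⟨j', rfl⟩ := Fin.exists_castSucc_eq.2 (hj.trans_le (Fin.le_last i)).ne
    simp
  congr 1
  · refine prod_congr rfl fun i _ => ?_
    rw [hq _ _ _ (hagree _)]
    simp
  · rw [hq _ _ _ (hagree _)]
    simp

lemma snoc_castSucc_history {A : Type} [Fintype A] {M : ℕ}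
    {q : (Fin (M + 1) → A) → Fin (M + 1) → A → ℝ}
    (hq : ∀ c c' i, (∀ j < i, c j = c' j) → q c i = q c' i) (z₀ : A) (c c' : Fin M → A)
    (i : Fin M) (h : ∀ j < i, c j = c' j) :
    q (Fin.snoc (α := fun _ => A) c z₀) i.castSucc =
      q (Fin.snoc (α := fun _ => A) c' z₀) i.castSucc := by
  refine hq _ _ _ fun j hj => ?_
  obtain ⟨j', rfl⟩ := Fin.exists_castSucc_eq.2 (hj.trans_le (Fin.le_last _)).ne
  simpa using h j' (by simpa using hj)

lemma snoc_mem_of_lt_castSucc {A : Type} {M : ℕ} {S : Fin (M + 1) → Finset A} {z₀ : A}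
    {c : Fin M → A} {i : Fin (M + 1)} (h : ∀ j : Fin M, j.castSucc < i → c j ∈ S j.castSucc) :
    ∀ j < i, (Fin.snoc (α := fun _ => A) c z₀ : Fin (M + 1) → A) j ∈ S j := by
  intro j hj
  obtain ⟨j', rfl⟩ := Fin.exists_castSucc_eq.2 (hj.trans_le (Fin.le_last _)).ne
  simpa using h j' hj

/-- Lower bound for a sequentially sampled tuple to stay in a box. -/
lemma prod_le_sum_sequential {A : Type} [Fintype A] [Nonempty A] {M : ℕ}
    (q : (Fin M → A) → Fin M → A → ℝ) (hq0 : ∀ c i z, 0 ≤ q c i z)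
    (hq : ∀ c c' i, (∀ j < i, c j = c' j) → q c i = q c' i) (S : Fin M → Finset A)
    (a : Fin M → ℝ) (ha : ∀ i, 0 ≤ a i)
    (h : ∀ c i, (∀ j < i, c j ∈ S j) → a i ≤ ∑ z ∈ S i, q c i z) :
    ∏ i, a i ≤ ∑ c ∈ Fintype.piFinset S, ∏ i, q c i (c i) := by
  induction M with
  | zero => simp
  | succ M ih =>
    obtain ⟨z₀⟩ := ‹Nonempty A›
    rw [sum_piFinset_sequential_succ q hq S z₀, Fin.prod_univ_castSucc]
    have h1 := ih (fun c i => q (Fin.snoc (α := fun _ => A) c z₀) i.castSucc)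
      (fun _ _ _ => hq0 _ _ _) (snoc_castSucc_history hq z₀) (fun i => S i.castSucc)
      (fun i => a i.castSucc) (fun i => ha _)
      (fun c i hc => h _ _ (snoc_mem_of_lt_castSucc fun j hj => hc j (by simpa using hj)))
    refine (mul_le_mul_of_nonneg_right h1 (ha _)).trans ?_
    rw [sum_mul]
    refine sum_le_sum fun c hc => mul_le_mul_of_nonneg_left ?_ (prod_nonneg fun _ _ => hq0 _ _ _)
    rw [Fintype.mem_piFinset] at hc
    exact h _ _ (snoc_mem_of_lt_castSucc fun j _ => hc j)

/-- Upper bound for a sequentially sampled tuple to stay in a box. -/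
lemma sum_sequential_le_prod {A : Type} [Fintype A] [Nonempty A] {M : ℕ}
    (q : (Fin M → A) → Fin M → A → ℝ) (hq0 : ∀ c i z, 0 ≤ q c i z)
    (hq : ∀ c c' i, (∀ j < i, c j = c' j) → q c i = q c' i) (S : Fin M → Finset A)
    (a : Fin M → ℝ) (ha : ∀ i, 0 ≤ a i)
    (h : ∀ c i, (∀ j < i, c j ∈ S j) → ∑ z ∈ S i, q c i z ≤ a i) :
    ∑ c ∈ Fintype.piFinset S, ∏ i, q c i (c i) ≤ ∏ i, a i := by
  induction M with
  | zero => simp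
  | succ M ih =>
    obtain ⟨z₀⟩ := ‹Nonempty A›
    rw [sum_piFinset_sequential_succ q hq S z₀, Fin.prod_univ_castSucc]
    have h1 := ih (fun c i => q (Fin.snoc (α := fun _ => A) c z₀) i.castSucc)
      (fun _ _ _ => hq0 _ _ _) (snoc_castSucc_history hq z₀) (fun i => S i.castSucc)
      (fun i => a i.castSucc) (fun i => ha _)
      (fun c i hc => h _ _ (snoc_mem_of_lt_castSucc fun j hj => hc j (by simpa using hj)))
    refine le_trans ?_ (mul_le_mul_of_nonneg_right h1 (ha _))
    rw [sum_mul]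
    refine sum_le_sum fun c hc => mul_le_mul_of_nonneg_left ?_ (prod_nonneg fun _ _ => hq0 _ _ _)
    rw [Fintype.mem_piFinset] at hc
    exact h _ _ (snoc_mem_of_lt_castSucc fun j _ => hc j)

/-- The conditional law of the `i`-th codeword given the previous ones. -/
def drawProb {α : Type} [Fintype α] (n : ℕ) (Q : α → ℝ) (d : (α × α → ℝ) → ℝ) (Δ : ℝ)
    {M : ℕ} (c : Fin M → Fin n → α) (i : Fin M) (z : Fin n → α) : ℝ :=
  if z ∈ feasible n Q d Δ c i then ((feasible n Q d Δ c i).card : ℝ)⁻¹ else 0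

section Ensemble

variable {α : Type} [Fintype α] {n : ℕ} {Q : α → ℝ} {d : (α × α → ℝ) → ℝ} {Δ : ℝ} {M : ℕ}

lemma drawProb_nonneg (c : Fin M → Fin n → α) (i : Fin M) (z : Fin n → α) :
    0 ≤ drawProb n Q d Δ c i z := by
  unfold drawProb; positivity

lemma rgvProb_nonneg (c : Fin M → Fin n → α) : 0 ≤ rgvProb n Q d Δ c :=
  prod_nonneg fun _ _ => drawProb_nonneg _ _ _

lemma drawProb_congr (c c' : Fin M → Fin n → α) (i : Fin M) (h : ∀ j < i, c j = c' j) :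
    drawProb n Q d Δ c i = drawProb n Q d Δ c' i := by
  have : feasible n Q d Δ c i = feasible n Q d Δ c' i := by
    unfold feasible
    refine filter_congr fun z _ => forall_congr' fun j => ?_
    exact ⟨fun H hj => h j hj ▸ H hj, fun H hj => (h j hj).symm ▸ H hj⟩
  funext z
  simp only [drawProb, this]

lemma rgvProb_eq_zero {c : Fin M → Fin n → α}
    (hc : c ∉ Fintype.piFinset fun _ : Fin M => typeClass n Q) : rgvProb n Q d Δ c = 0 := by
  rw [Fintype.mem_piFinset, not_forall] at hc
  obtain ⟨i, hi⟩ := hc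
  refine prod_eq_zero (mem_univ i) (if_neg fun h => hi (mem_filter.1 h).1)

lemma sum_drawProb (c : Fin M → Fin n → α) (i : Fin M) (S : Finset (Fin n → α)) :
    ∑ z ∈ S, drawProb n Q d Δ c i z =
      #{z ∈ feasible n Q d Δ c i | z ∈ S} * (#(feasible n Q d Δ c i) : ℝ)⁻¹ := by
  unfold drawProb
  rw [← sum_filter, sum_const, nsmul_eq_mul]
  congr 3
  ext z
  simp [and_comm]

lemma sum_drawProb_le_one (c : Fin M → Fin n → α) (i : Fin M) (S : Finset (Fin n → α)) :
    ∑ z ∈ S, drawProb n Q d Δ c i z ≤ 1 := by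
  rw [sum_drawProb, ← div_eq_mul_inv]
  refine div_le_one_of_le₀ ?_ (Nat.cast_nonneg _)
  exact_mod_cast card_filter_le _ _

lemma card_typeClass_sub_le_card_feasible {v : ℝ}
    (hv : ∀ x ∈ typeClass n Q, (#{z ∈ typeClass n Q | ¬ Δ < d (emp2 n z x)} : ℝ) ≤ v)
    (hv0 : 0 ≤ v) {c : Fin M → Fin n → α} {i : Fin M} (hc : ∀ j < i, c j ∈ typeClass n Q) :
    (#(typeClass n Q) : ℝ) - M * v ≤ #(feasible n Q d Δ c i) := by
  have h1 : typeClass n Q ⊆ feasible n Q d Δ c i ∪ ({j | j < i} : Finset (Fin M)).biUnion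
      fun j => {z ∈ typeClass n Q | ¬ Δ < d (emp2 n z (c j))} := by
    intro z hz
    by_cases h : z ∈ feasible n Q d Δ c i
    · exact mem_union_left _ h
    · refine mem_union_right _ ?_
      simp only [feasible, mem_filter, hz, true_and, not_forall] at h
      obtain ⟨j, hj, hd⟩ := h
      exact mem_biUnion.2 ⟨j, by simpa using hj, mem_filter.2 ⟨hz, hd⟩⟩
  have h2 := (card_le_card h1).trans ((card_union_le _ _).trans
    (Nat.add_le_add_left card_biUnion_le _))
  have h3 : (#(typeClass n Q) : ℝ) ≤ #(feasible n Q d Δ c i) +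
      ∑ j ∈ ({j | j < i} : Finset (Fin M)),
        (#{z ∈ typeClass n Q | ¬ Δ < d (emp2 n z (c j))} : ℝ) := by
    exact_mod_cast h2
  have h4 : ∑ j ∈ ({j | j < i} : Finset (Fin M)),
        (#{z ∈ typeClass n Q | ¬ Δ < d (emp2 n z (c j))} : ℝ) ≤ M * v := by
    refine (sum_le_card_nsmul _ _ v fun j hj => hv _ (hc j (by simpa using hj))).trans ?_
    rw [nsmul_eq_mul]
    refine mul_le_mul_of_nonneg_right ?_ hv0
    exact_mod_cast (card_le_univ _).trans (by simp)
  linarith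

/-- Joint law of finitely many codewords: at most a constant per codeword times uniform. -/
lemma prob_comp_le [Nonempty α] {s : ℝ} (hs : 0 < s)
    (hF : ∀ (c : Fin M → Fin n → α) i, (∀ j < i, c j ∈ typeClass n Q) →
      s ≤ #(feasible n Q d Δ c i)) {k : ℕ} (f : Fin k → Fin M) (hf : Function.Injective f)
    (E : (Fin k → Fin n → α) → Prop) :
    prob n Q d Δ M (fun c => E (c ∘ f)) ≤
      s⁻¹ ^ k * #{x ∈ Fintype.piFinset fun _ : Fin k => typeClass n Q | E x} := by
  have hfix : ∀ x : Fin k → Fin n → α,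
      ∑ c ∈ Fintype.piFinset (fun i : Fin M => {z ∈ typeClass n Q | ∀ j, f j = i → x j = z}),
        rgvProb n Q d Δ c ≤ s⁻¹ ^ k := by
    intro x
    have h1 := sum_sequential_le_prod (drawProb n Q d Δ) drawProb_nonneg drawProb_congr
      (fun i : Fin M => {z ∈ typeClass n Q | ∀ j, f j = i → x j = z})
      (fun i => if i ∈ univ.image f then s⁻¹ else 1) (fun i => by positivity) ?_
    · rw [prod_ite_mem, univ_inter, prod_const, card_image_of_injective _ hf, card_univ,
        Fintype.card_fin] at h1
      exact h1
    · intro c i hc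
      by_cases hi : i ∈ univ.image f
      · rw [if_pos hi]
        obtain ⟨j, -, rfl⟩ := mem_image.1 hi
        have hFi := hF c (f j) fun j' hj' => (mem_filter.1 (hc j' hj')).1
        rw [sum_drawProb]
        have h2 : #{z ∈ feasible n Q d Δ c (f j) |
            z ∈ ({z ∈ typeClass n Q | ∀ j', f j' = f j → x j' = z} : Finset _)} ≤ 1 := by
          refine card_le_one.2 fun a ha b hb => ?_
          simp only [mem_filter] at ha hb
          rw [← ha.2.2 j rfl, ← hb.2.2 j rfl]
        calc _ ≤ (1 : ℝ) * (#(feasible n Q d Δ c (f j)) : ℝ)⁻¹ := by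
              gcongr; exact_mod_cast h2
          _ ≤ _ := by rw [one_mul]; gcongr
      · rw [if_neg hi]
        exact sum_drawProb_le_one _ _ _
  unfold prob
  rw [← sum_filter]
  have hmaps : ∀ c ∈ ({c ∈ Fintype.piFinset fun _ : Fin M => typeClass n Q | E (c ∘ f)} :
      Finset (Fin M → Fin n → α)),
      c ∘ f ∈ ({x ∈ Fintype.piFinset fun _ : Fin k => typeClass n Q | E x} : Finset _) := by
    intro c hc
    rw [mem_filter, Fintype.mem_piFinset] at hc ⊢
    exact ⟨fun j => hc.1 _, hc.2⟩
  calc ∑ c with E (c ∘ f), rgvProb n Q d Δ c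
      = ∑ c ∈ Fintype.piFinset fun _ : Fin M => typeClass n Q with E (c ∘ f),
          rgvProb n Q d Δ c := by
        symm
        refine sum_subset (filter_subset_filter _ (subset_univ _)) fun c hc hc' => ?_
        refine rgvProb_eq_zero fun h => hc' (mem_filter.2 ⟨h, (mem_filter.1 hc).2⟩)
    _ ≤ ∑ x ∈ Fintype.piFinset fun _ : Fin k => typeClass n Q with E x, s⁻¹ ^ k := by
        rw [← sum_fiberwise_of_maps_to hmaps]
        refine sum_le_sum fun x _ => le_trans ?_ (hfix x)
        refine sum_le_sum_of_subset_of_nonneg (fun c hc => ?_) fun _ _ _ => rgvProb_nonneg _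
        simp only [mem_filter, Fintype.mem_piFinset] at hc ⊢
        intro i
        refine ⟨hc.1.1 i, ?_⟩
        rintro j rfl
        rw [← hc.2]
        rfl
    _ = _ := by rw [sum_const, nsmul_eq_mul, mul_comm]

/-- The RGV weights add up to one as soon as the construction never gets stuck. -/
lemma sum_rgvProb [Nonempty α]
    (hF : ∀ (c : Fin M → Fin n → α) i, (∀ j < i, c j ∈ typeClass n Q) →
      0 < #(feasible n Q d Δ c i)) :
    ∑ c : Fin M → Fin n → α, rgvProb n Q d Δ c = 1 := by
  have h0 : ∑ c ∈ Fintype.piFinset fun _ : Fin M => typeClass n Q, rgvProb n Q d Δ c =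
      ∑ c : Fin M → Fin n → α, rgvProb n Q d Δ c :=
    sum_subset (subset_univ _) fun c _ hc => rgvProb_eq_zero hc
  rw [← h0]
  refine le_antisymm ?_ ?_
  · have := sum_sequential_le_prod (drawProb n Q d Δ) drawProb_nonneg drawProb_congr
      (fun _ : Fin M => typeClass n Q) (fun _ => 1) (fun _ => zero_le_one)
      (fun c i _ => sum_drawProb_le_one c i _)
    rwa [prod_const_one] at this
  · have := prod_le_sum_sequential (drawProb n Q d Δ) drawProb_nonneg drawProb_congr
      (fun _ : Fin M => typeClass n Q) (fun _ => 1) (fun _ => zero_le_one) ?_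
    · rwa [prod_const_one] at this
    · intro c i hc
      have hpos := hF c i hc
      have hsub : ∀ z ∈ feasible n Q d Δ c i, z ∈ typeClass n Q := fun z hz =>
        (mem_filter.1 hz).1
      rw [sum_drawProb, filter_true_of_mem hsub, mul_inv_cancel₀ (by positivity)]

/-- Lower bound for the joint law of two codewords at admissible distance. -/
lemma le_sum_rgvProb_pair [Nonempty α] {s v : ℝ} (hs : 0 < s)
    (hv : ∀ x ∈ typeClass n Q, (#{z ∈ typeClass n Q | ¬ Δ < d (emp2 n z x)} : ℝ) ≤ v)
    (hv0 : 0 ≤ v) (hvs : 2 * v ≤ s)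
    (hF : ∀ (c : Fin M → Fin n → α) i, (∀ j < i, c j ∈ typeClass n Q) →
      s ≤ #(feasible n Q d Δ c i)) (hsymm : ∀ x y : Fin n → α, d (emp2 n x y) = d (emp2 n y x))
    {m m' : Fin M} (hm : m ≠ m') {x x' : Fin n → α} (hx : x ∈ typeClass n Q)
    (hx' : x' ∈ typeClass n Q) (hd : Δ < d (emp2 n x x')) :
    (1 - M * (2 * v / s)) * (#(typeClass n Q) : ℝ)⁻¹ ^ 2 ≤
      ∑ c : Fin M → Fin n → α with c m = x ∧ c m' = x', rgvProb n Q d Δ c := by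
  set T := typeClass n Q with hT
  set G : Finset (Fin n → α) := {z ∈ T | Δ < d (emp2 n z x) ∧ Δ < d (emp2 n z x')} with hG
  set S : Fin M → Finset (Fin n → α) := fun i => if i = m then {x} else if i = m' then {x'} else G
    with hS
  have hST : ∀ i, S i ⊆ T := by
    intro i
    simp only [hS]
    split_ifs
    · simpa using hx
    · simpa using hx'
    · exact filter_subset _ _
  have hSx : ∀ i z, i ≠ m → z ∈ S i → Δ < d (emp2 n x z) := by
    intro i z hi hz
    simp only [hS, if_neg hi] at hz
    split_ifs at hz
    · rw [mem_singleton] at hz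
      rwa [hz]
    · rw [hsymm]
      exact (mem_filter.1 hz).2.1
  have hSx' : ∀ i z, i ≠ m' → z ∈ S i → Δ < d (emp2 n x' z) := by
    intro i z hi hz
    simp only [hS, if_neg hi] at hz
    split_ifs at hz
    · rw [mem_singleton] at hz
      rwa [hz, hsymm]
    · rw [hsymm]
      exact (mem_filter.1 hz).2.2
  have hη0 : 0 ≤ 2 * v / s := by positivity
  have hη1 : 2 * v / s ≤ 1 := (div_le_one hs).2 hvs
  have hTpos : (0 : ℝ) < #T := by exact_mod_cast card_pos.2 ⟨x, hx⟩
  have hfixed : ∀ (c : Fin M → Fin n → α) i y, (∀ j < i, c j ∈ S j) → y ∈ T →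
      (∀ j z, j ≠ i → z ∈ S j → Δ < d (emp2 n y z)) →
      (#T : ℝ)⁻¹ ≤ ∑ z ∈ {y}, drawProb n Q d Δ c i z := by
    intro c i y hc hy hyd
    have hmem : y ∈ feasible n Q d Δ c i :=
      mem_filter.2 ⟨hy, fun j hj => hyd j _ hj.ne (hc j hj)⟩
    rw [sum_singleton, drawProb, if_pos hmem]
    have h1 : (0 : ℝ) < #(feasible n Q d Δ c i) := by exact_mod_cast card_pos.2 ⟨_, hmem⟩
    gcongr
    exact filter_subset _ _
  have hfree : ∀ (c : Fin M → Fin n → α) i, (∀ j < i, c j ∈ S j) →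
      1 - 2 * v / s ≤ ∑ z ∈ G, drawProb n Q d Δ c i z := by
    intro c i hc
    have hFi := hF c i fun j hj => hST j (hc j hj)
    set F := feasible n Q d Δ c i with hFdef
    have hFpos : (0 : ℝ) < #F := hs.trans_le hFi
    rw [sum_drawProb]
    have h1 : F ⊆ ({z ∈ F | z ∈ G} : Finset _) ∪
        ({z ∈ T | ¬ Δ < d (emp2 n z x)} ∪ {z ∈ T | ¬ Δ < d (emp2 n z x')}) := by
      intro z hz
      have hzT : z ∈ T := (mem_filter.1 hz).1
      simp only [mem_union, mem_filter, hG, hz, hzT, true_and]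
      tauto
    have h2 : (#F : ℝ) ≤ #{z ∈ F | z ∈ G} +
        (#{z ∈ T | ¬ Δ < d (emp2 n z x)} + #{z ∈ T | ¬ Δ < d (emp2 n z x')}) := by
      exact_mod_cast (card_le_card h1).trans ((card_union_le _ _).trans
        (Nat.add_le_add_left (card_union_le _ _) _))
    have h3 := hv x hx
    have h4 := hv x' hx'
    rw [← div_eq_mul_inv, le_div_iff₀ hFpos]
    have h5 : 2 * v ≤ 2 * v / s * #F := by
      rw [div_mul_eq_mul_div, le_div_iff₀ hs]
      gcongr
    linarith
  have hmain := prod_le_sum_sequential (drawProb n Q d Δ) drawProb_nonneg drawProb_congr S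
    (fun i => if i = m then (#T : ℝ)⁻¹ else if i = m' then (#T : ℝ)⁻¹ else 1 - 2 * v / s)
    (fun i => by
      have : 0 ≤ 1 - 2 * v / s := by linarith
      positivity) ?_
  · have hprod : (1 - M * (2 * v / s)) * (#T : ℝ)⁻¹ ^ 2 ≤ ∏ i : Fin M,
        (if i = m then (#T : ℝ)⁻¹ else if i = m' then (#T : ℝ)⁻¹ else 1 - 2 * v / s) := by
      rw [← mul_prod_erase univ _ (mem_univ m),
        ← mul_prod_erase (univ.erase m) _ (mem_erase.2 ⟨hm.symm, mem_univ m'⟩)]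
      rw [if_pos rfl, if_neg hm.symm, if_pos rfl]
      have h6 : ∏ i ∈ (univ.erase m).erase m', (if i = m then (#T : ℝ)⁻¹ else
          if i = m' then (#T : ℝ)⁻¹ else 1 - 2 * v / s) =
          (1 - 2 * v / s) ^ #((univ.erase m).erase m') := by
        rw [← prod_const]
        refine prod_congr rfl fun i hi => ?_
        rw [mem_erase, mem_erase] at hi
        rw [if_neg hi.2.1, if_neg hi.1]
      rw [h6]
      have h7 : (1 - 2 * v / s) ^ M ≤ (1 - 2 * v / s) ^ #((univ.erase m).erase m') := by
        refine pow_le_pow_of_le_one (by linarith) (by linarith) ?_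
        exact (card_le_univ _).trans (by simp)
      have h8 := one_add_mul_le_pow (a := -(2 * v / s)) (by linarith) M
      have h9 : 1 - M * (2 * v / s) ≤ (1 - 2 * v / s) ^ #((univ.erase m).erase m') := by
        refine le_trans ?_ h7
        rwa [mul_neg, ← sub_eq_add_neg, ← sub_eq_add_neg] at h8
      calc _ ≤ (1 - 2 * v / s) ^ #((univ.erase m).erase m') * (#T : ℝ)⁻¹ ^ 2 := by gcongr
        _ = _ := by ring
    refine hprod.trans (hmain.trans ?_)
    refine sum_le_sum_of_subset_of_nonneg (fun c hc => ?_) fun _ _ _ => rgvProb_nonneg _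
    rw [Fintype.mem_piFinset] at hc
    rw [mem_filter_univ]
    have e1 := hc m
    have e2 := hc m'
    simp only [hS, if_true, if_neg hm.symm, mem_singleton] at e1 e2
    exact ⟨e1, e2⟩
  · intro c i hc
    simp only [hS]
    split_ifs with h1 h2
    · subst h1
      exact hfixed c i x hc hx hSx
    · subst h2
      exact hfixed c i x' hc hx' hSx'
    · exact hfree c i hc

end Ensemble

section Moments

variable {α : Type} [Fintype α] {n : ℕ} {Q : α → ℝ} {d : (α × α → ℝ) → ℝ} {Δ : ℝ} {M : ℕ}
  {P : α × α → ℝ}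

lemma prob_nonneg (E : (Fin M → Fin n → α) → Prop) : 0 ≤ prob n Q d Δ M E :=
  sum_nonneg fun c _ => by
    have := rgvProb_nonneg (n := n) (Q := Q) (d := d) (Δ := Δ) c
    positivity

lemma prob_mono {E F : (Fin M → Fin n → α) → Prop} (h : ∀ c, E c → F c) :
    prob n Q d Δ M E ≤ prob n Q d Δ M F := by
  unfold prob
  rw [← sum_filter, ← sum_filter]
  exact sum_le_sum_of_subset_of_nonneg (monotone_filter_right _ fun c _ => h c)
    fun _ _ _ => rgvProb_nonneg _

lemma prob_eq_sum_filter (E : (Fin M → Fin n → α) → Prop) [DecidablePred E] :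
    prob n Q d Δ M E = ∑ c with E c, rgvProb n Q d Δ c := by
  rw [prob, sum_filter]
  exact sum_congr rfl fun c _ => by congr

lemma Nenum_eq_sum (c : Fin M → Fin n → α) :
    (Nenum n P c : ℝ) = ∑ p ∈ (univ : Finset (Fin M)).offDiag,
      if emp2 n (c p.1) (c p.2) = P then 1 else 0 := by
  rw [sum_boole, Nenum]
  congr 2
  ext p
  simp

lemma expect_Nenum : expect n Q d Δ M (fun c => (Nenum n P c : ℝ)) =
    ∑ p ∈ (univ : Finset (Fin M)).offDiag,
      prob n Q d Δ M (fun c => emp2 n (c p.1) (c p.2) = P) := by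
  simp only [expect, prob, Nenum_eq_sum, mul_sum]
  rw [sum_comm]
  refine sum_congr rfl fun p _ => sum_congr rfl fun c _ => ?_
  rw [mul_ite, mul_one, mul_zero]
  congr

lemma expect_Nenum_sq : expect n Q d Δ M (fun c => (Nenum n P c : ℝ) ^ 2) =
    ∑ p ∈ (univ : Finset (Fin M)).offDiag, ∑ p' ∈ (univ : Finset (Fin M)).offDiag,
      prob n Q d Δ M (fun c => emp2 n (c p.1) (c p.2) = P ∧ emp2 n (c p'.1) (c p'.2) = P) := by
  simp only [expect, prob, Nenum_eq_sum, sq]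
  simp_rw [sum_mul_sum, mul_sum]
  rw [sum_comm]
  refine sum_congr rfl fun p _ => ?_
  rw [sum_comm]
  refine sum_congr rfl fun p' _ => sum_congr rfl fun c _ => ?_
  by_cases h1 : emp2 n (c p.1) (c p.2) = P <;> by_cases h2 : emp2 n (c p'.1) (c p'.2) = P <;>
    simp [h1, h2]

/-- Lower bound for the mean of the type enumerator. -/
lemma le_expect_Nenum [Nonempty α] {s v : ℝ} (hs : 0 < s)
    (hv : ∀ x ∈ typeClass n Q, (#{z ∈ typeClass n Q | ¬ Δ < d (emp2 n z x)} : ℝ) ≤ v)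
    (hv0 : 0 ≤ v) (hvs : 2 * v ≤ s)
    (hF : ∀ (c : Fin M → Fin n → α) i, (∀ j < i, c j ∈ typeClass n Q) →
      s ≤ #(feasible n Q d Δ c i)) (hd : IsDistance d) (hP : Joint Q P) (hPd : Δ < d P) :
    ((M : ℝ) * (M - 1)) * ((1 - M * (2 * v / s)) * Lsize n Q P) ≤
      expect n Q d Δ M (fun c => (Nenum n P c : ℝ)) := by
  have hsymm : ∀ x y : Fin n → α, d (emp2 n x y) = d (emp2 n y x) := fun x y => by
    rw [← hd.2]
    congr 1
    funext p
    exact emp2_swap n x y _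
  have hpair : ∀ p ∈ (univ : Finset (Fin M)).offDiag, (1 - M * (2 * v / s)) * Lsize n Q P ≤
      prob n Q d Δ M (fun c => emp2 n (c p.1) (c p.2) = P) := by
    intro p hp
    have hp' : p.1 ≠ p.2 := (mem_offDiag.1 hp).2.2
    rw [prob_eq_sum_filter]
    have hmaps : ∀ c ∈ ({c | emp2 n (c p.1) (c p.2) = P} : Finset (Fin M → Fin n → α)),
        (c p.1, c p.2) ∈ typeClass2 n P := fun c hc => by
      simpa [typeClass2] using hc
    rw [← sum_fiberwise_of_maps_to hmaps]
    have hterm : ∀ y ∈ typeClass2 n P, (1 - M * (2 * v / s)) * (#(typeClass n Q) : ℝ)⁻¹ ^ 2 ≤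
        ∑ c ∈ ({c | emp2 n (c p.1) (c p.2) = P} : Finset (Fin M → Fin n → α)) with
          (c p.1, c p.2) = y, rgvProb n Q d Δ c := by
      rintro ⟨x, x'⟩ hy
      rw [typeClass2, mem_filter_univ] at hy
      obtain ⟨hx, hx'⟩ := hP.mem_typeClass hy
      refine (le_sum_rgvProb_pair hs hv hv0 hvs hF hsymm hp' hx hx' (by rwa [hy])).trans_eq ?_
      refine sum_congr ?_ fun _ _ => rfl
      ext c
      simp only [mem_filter, mem_univ, true_and, Prod.mk.injEq]
      refine ⟨fun h => ⟨?_, h⟩, fun h => h.2⟩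
      rw [h.1, h.2]
      exact hy
    refine le_trans (le_of_eq ?_) (card_nsmul_le_sum _ _ _ hterm)
    rw [nsmul_eq_mul, Lsize]
    ring
  rw [expect_Nenum]
  refine le_trans (le_of_eq ?_) (card_nsmul_le_sum _ _ _ hpair)
  rw [nsmul_eq_mul, offDiag_card, card_univ, Fintype.card_fin, Nat.cast_sub (Nat.le_mul_self M)]
  push_cast
  ring

/-- Two codewords of a given joint type. -/
lemma prob_pair_le [Nonempty α] {s : ℝ} (hs : 0 < s)
    (hF : ∀ (c : Fin M → Fin n → α) i, (∀ j < i, c j ∈ typeClass n Q) →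
      s ≤ #(feasible n Q d Δ c i)) {a b : Fin M} (hab : a ≠ b) :
    prob n Q d Δ M (fun c => emp2 n (c a) (c b) = P) ≤ s⁻¹ ^ 2 * #(typeClass2 n P) := by
  refine (prob_comp_le hs hF ![a, b] ?_ fun x => emp2 n (x 0) (x 1) = P).trans ?_
  · simpa [Function.Injective, Fin.forall_fin_two] using ⟨hab, hab.symm⟩
  · gcongr
    refine card_le_card_of_injOn (fun x => (x 0, x 1)) ?_ ?_
    · intro x hx
      simp only [coe_filter, Set.mem_ofPred_eq, typeClass2, mem_univ, true_and] at hx ⊢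
      exact hx.2
    · intro x _ y _ hxy
      simp only [Prod.mk.injEq] at hxy
      funext i
      fin_cases i
      exacts [hxy.1, hxy.2]

/-- Two pairs of codewords sharing one codeword. -/
lemma prob_shared_le [Nonempty α] {s : ℝ} (hs : 0 < s)
    (hF : ∀ (c : Fin M → Fin n → α) i, (∀ j < i, c j ∈ typeClass n Q) →
      s ≤ #(feasible n Q d Δ c i)) {a b e : Fin M} (hab : a ≠ b) (hae : a ≠ e) (hbe : b ≠ e)
    (r₁ r₂ : (Fin n → α) → (Fin n → α) → Prop) [∀ x, DecidablePred (r₁ x)]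
    [∀ x, DecidablePred (r₂ x)] {ν : ℕ}
    (h₁ : ∀ x ∈ typeClass n Q, #{y | r₁ x y} = ν) (h₂ : ∀ x ∈ typeClass n Q, #{y | r₂ x y} = ν) :
    prob n Q d Δ M (fun c => r₁ (c a) (c b) ∧ r₂ (c a) (c e)) ≤
      s⁻¹ ^ 3 * (#(typeClass n Q) * ν ^ 2) := by
  refine (prob_comp_le hs hF ![a, b, e] ?_
    fun x => r₁ (x 0) (x 1) ∧ r₂ (x 0) (x 2)).trans ?_
  · intro i j
    fin_cases i <;> fin_cases j <;> simp [hab, hae, hbe, hab.symm, hae.symm, hbe.symm]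
  · gcongr
    have hcard : #((typeClass n Q).sigma fun x =>
        ({y | r₁ x y} : Finset (Fin n → α)) ×ˢ ({y | r₂ x y} : Finset (Fin n → α))) =
        #(typeClass n Q) * ν ^ 2 := by
      rw [card_sigma, ← smul_eq_mul, ← sum_const]
      refine sum_congr rfl fun x hx => ?_
      rw [card_product, h₁ x hx, h₂ x hx, sq]
    rw [← Nat.cast_pow, ← Nat.cast_mul, ← hcard, Nat.cast_le]
    refine card_le_card_of_injOn (fun x => ⟨x 0, (x 1, x 2)⟩) ?_ ?_
    · intro x hx
      simp only [coe_filter, Set.mem_ofPred_eq, Fintype.mem_piFinset] at hx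
      simpa using ⟨hx.1 0, hx.2⟩
    · intro x _ y _ hxy
      simp only [Sigma.mk.injEq, heq_eq_eq, Prod.mk.injEq] at hxy
      funext i
      fin_cases i
      exacts [hxy.1, hxy.2.1, hxy.2.2]

/-- Two disjoint pairs of codewords. -/
lemma prob_disjoint_le [Nonempty α] {s : ℝ} (hs : 0 < s)
    (hF : ∀ (c : Fin M → Fin n → α) i, (∀ j < i, c j ∈ typeClass n Q) →
      s ≤ #(feasible n Q d Δ c i)) (f : Fin 4 → Fin M) (hf : Function.Injective f) :
    prob n Q d Δ M (fun c => emp2 n (c (f 0)) (c (f 1)) = P ∧ emp2 n (c (f 2)) (c (f 3)) = P) ≤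
      s⁻¹ ^ 4 * (#(typeClass2 n P) : ℝ) ^ 2 := by
  refine (prob_comp_le hs hF f hf
    fun x => emp2 n (x 0) (x 1) = P ∧ emp2 n (x 2) (x 3) = P).trans ?_
  gcongr
  rw [← Nat.cast_pow, Nat.cast_le, sq, ← card_product]
  refine card_le_card_of_injOn (fun x => ((x 0, x 1), (x 2, x 3))) ?_ ?_
  · intro x hx
    simp only [coe_filter, Set.mem_ofPred_eq] at hx
    simpa [typeClass2] using hx.2
  · intro x _ y _ hxy
    simp only [Prod.mk.injEq] at hxy
    funext i
    fin_cases i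
    exacts [hxy.1.1, hxy.1.2, hxy.2.1, hxy.2.2]

/-- Upper bound for the probability that two prescribed pairs both have joint type `P`. -/
lemma prob_two_pairs_le [Nonempty α] (hn : 0 < n) {s : ℝ} (hs : 0 < s)
    (hsT : s ≤ #(typeClass n Q))
    (hF : ∀ (c : Fin M → Fin n → α) i, (∀ j < i, c j ∈ typeClass n Q) →
      s ≤ #(feasible n Q d Δ c i)) (hP : Joint Q P) {p p' : Fin M × Fin M}
    (hp : p.1 ≠ p.2) (hp' : p'.1 ≠ p'.2) :
    prob n Q d Δ M (fun c => emp2 n (c p.1) (c p.2) = P ∧ emp2 n (c p'.1) (c p'.2) = P) ≤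
      (if p' ∈ ({p, p.swap} : Finset (Fin M × Fin M)) then s⁻¹ ^ 2 * (#(typeClass2 n P) : ℝ) else 0) +
        s⁻¹ ^ 4 * (#(typeClass2 n P) : ℝ) ^ 2 := by
  obtain ⟨a, b⟩ := p
  obtain ⟨a', b'⟩ := p'
  simp only at hp hp'
  have hnn : 0 ≤ s⁻¹ ^ 4 * (#(typeClass2 n P) : ℝ) ^ 2 := by positivity
  split_ifs with hmem
  · refine le_trans ?_ (le_add_of_nonneg_right hnn)
    exact (prob_mono fun c h => h.1).trans (prob_pair_le hs hF hp)
  · rw [zero_add]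
    have hT : 0 < #(typeClass n Q) := by exact_mod_cast hs.trans_le hsT
    obtain ⟨x₀, hx₀⟩ := card_pos.1 hT
    set ν := #{y | emp2 n x₀ y = P} with hν
    have hT2 : #(typeClass2 n P) = #(typeClass n Q) * ν := hP.card_typeClass2_eq hn hx₀
    have hr : ∀ x ∈ typeClass n Q, #{y | emp2 n x y = P} = ν := fun x hx =>
      Nat.eq_of_mul_eq_mul_left hT ((hP.card_typeClass2_eq hn hx).symm.trans hT2)
    have hr' : ∀ x ∈ typeClass n Q, #{y | emp2 n y x = P} = ν := fun x hx =>
      Nat.eq_of_mul_eq_mul_left hT ((hP.card_typeClass2_eq' hn hx).symm.trans hT2)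
    have hshared : s⁻¹ ^ 3 * (#(typeClass n Q) * (ν : ℝ) ^ 2) ≤
        s⁻¹ ^ 4 * (#(typeClass2 n P) : ℝ) ^ 2 := by
      have h1 : 1 ≤ s⁻¹ * #(typeClass n Q) := by
        rw [inv_mul_eq_div, one_le_div hs]
        exact hsT
      rw [hT2]
      push_cast
      calc _ ≤ s⁻¹ ^ 3 * (#(typeClass n Q) * (ν : ℝ) ^ 2) * (s⁻¹ * #(typeClass n Q)) :=
            le_mul_of_one_le_right (by positivity) h1
        _ = _ := by ring
    simp only [mem_insert, mem_singleton, Prod.mk.injEq, Prod.swap_prod_mk, not_or] at hmem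
    by_cases h1 : a' = a
    · subst h1
      refine le_trans ?_ hshared
      exact prob_shared_le hs hF hp hp' (fun h => hmem.1 ⟨rfl, h.symm⟩)
        (fun x y => emp2 n x y = P) (fun x y => emp2 n x y = P) hr hr
    by_cases h2 : a' = b
    · subst h2
      refine le_trans ?_ hshared
      exact prob_shared_le hs hF hp.symm hp' (fun h => hmem.2 ⟨rfl, h.symm⟩)
        (fun x y => emp2 n y x = P) (fun x y => emp2 n x y = P) hr' hr
    by_cases h3 : b' = a
    · subst h3
      refine le_trans ?_ hshared
      exact prob_shared_le hs hF hp hp'.symm (Ne.symm h2)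
        (fun x y => emp2 n x y = P) (fun x y => emp2 n y x = P) hr hr'
    by_cases h4 : b' = b
    · subst h4
      refine le_trans ?_ hshared
      exact prob_shared_le hs hF hp.symm hp'.symm (Ne.symm h1)
        (fun x y => emp2 n y x = P) (fun x y => emp2 n y x = P) hr' hr'
    refine prob_disjoint_le hs hF ![a, b, a', b'] ?_
    intro i j
    fin_cases i <;> fin_cases j <;>
      simp [hp, hp', h1, h2, h3, h4, Ne.symm hp, Ne.symm hp', Ne.symm h1, Ne.symm h2, Ne.symm h3,
        Ne.symm h4]

/-- Upper bound for the second moment of the type enumerator. -/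
lemma expect_Nenum_sq_le [Nonempty α] (hn : 0 < n) {s : ℝ} (hs : 0 < s)
    (hsT : s ≤ #(typeClass n Q))
    (hF : ∀ (c : Fin M → Fin n → α) i, (∀ j < i, c j ∈ typeClass n Q) →
      s ≤ #(feasible n Q d Δ c i)) (hP : Joint Q P) :
    expect n Q d Δ M (fun c => (Nenum n P c : ℝ) ^ 2) ≤
      ((M : ℝ) * (M - 1)) * (2 * (s⁻¹ ^ 2 * (#(typeClass2 n P) : ℝ))) +
        ((M : ℝ) * (M - 1)) ^ 2 * (s⁻¹ ^ 4 * (#(typeClass2 n P) : ℝ) ^ 2) := by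
  have hcard : (#((univ : Finset (Fin M)).offDiag) : ℝ) = (M : ℝ) * (M - 1) := by
    rw [offDiag_card, card_univ, Fintype.card_fin, Nat.cast_sub (Nat.le_mul_self M)]
    push_cast
    ring
  rw [expect_Nenum_sq]
  set u := s⁻¹ ^ 2 * (#(typeClass2 n P) : ℝ)
  set w := s⁻¹ ^ 4 * (#(typeClass2 n P) : ℝ) ^ 2
  have hu : 0 ≤ u := by positivity
  have hinner : ∀ p ∈ (univ : Finset (Fin M)).offDiag,
      ∑ p' ∈ (univ : Finset (Fin M)).offDiag,
        prob n Q d Δ M (fun c => emp2 n (c p.1) (c p.2) = P ∧ emp2 n (c p'.1) (c p'.2) = P) ≤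
      2 * u + (M : ℝ) * (M - 1) * w := by
    intro p hp
    refine (sum_le_sum fun p' hp' => prob_two_pairs_le hn hs hsT hF hP
      (mem_offDiag.1 hp).2.2 (mem_offDiag.1 hp').2.2).trans ?_
    rw [sum_add_distrib, sum_const, nsmul_eq_mul, hcard, ← sum_filter, sum_const, nsmul_eq_mul]
    have h1 : (#{p' ∈ (univ : Finset (Fin M)).offDiag |
        p' ∈ ({p, p.swap} : Finset (Fin M × Fin M))} : ℝ) ≤ 2 := by
      have : #{p' ∈ (univ : Finset (Fin M)).offDiag |
        p' ∈ ({p, p.swap} : Finset (Fin M × Fin M))} ≤ 2 :=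
        (card_le_card fun q hq => (mem_filter.1 hq).2).trans card_le_two
      exact_mod_cast this
    gcongr
  refine (sum_le_card_nsmul _ _ _ hinner).trans_eq ?_
  rw [nsmul_eq_mul, hcard]
  ring

/-- Chebyshev's inequality for the lower tail under a normalised RGV ensemble. -/
lemma prob_lt_le {X : (Fin M → Fin n → α) → ℝ}
    (hone : ∑ c : Fin M → Fin n → α, rgvProb n Q d Δ c = 1)
    {B r V θ : ℝ} (hB : 0 < B) (hr : r < 1) (hr0 : 0 ≤ r) (hθ : θ ≤ r * B)
    (hmean : B ≤ expect n Q d Δ M X) (hsq : expect n Q d Δ M (fun c => X c ^ 2) ≤ V) :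
    prob n Q d Δ M (fun c => X c < θ) ≤ ((1 - r) ^ 2)⁻¹ * (V / B ^ 2 - 1) := by
  set μ := expect n Q d Δ M X with hμ
  have hμpos : 0 < μ := hB.trans_le hmean
  have hvar : ∑ c : Fin M → Fin n → α, rgvProb n Q d Δ c * (X c - μ) ^ 2 =
      expect n Q d Δ M (fun c => X c ^ 2) - μ ^ 2 := by
    have : ∀ c : Fin M → Fin n → α, rgvProb n Q d Δ c * (X c - μ) ^ 2 =
        rgvProb n Q d Δ c * X c ^ 2 - 2 * μ * (rgvProb n Q d Δ c * X c) +
          μ ^ 2 * rgvProb n Q d Δ c := fun c => by ring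
    rw [sum_congr rfl fun c _ => this c, sum_add_distrib, sum_sub_distrib, ← mul_sum, ← mul_sum,
      hone]
    change expect n Q d Δ M (fun c => X c ^ 2) - 2 * μ * μ + μ ^ 2 * 1 = _
    ring
  have hcheb : (1 - r) ^ 2 * μ ^ 2 * prob n Q d Δ M (fun c => X c < θ) ≤
      expect n Q d Δ M (fun c => X c ^ 2) - μ ^ 2 := by
    rw [← hvar, prob, mul_sum]
    refine sum_le_sum fun c _ => ?_
    have hw := rgvProb_nonneg (n := n) (Q := Q) (d := d) (Δ := Δ) c
    split_ifs with hc
    · rw [mul_comm]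
      refine mul_le_mul_of_nonneg_left ?_ hw
      have h1 : r * B ≤ r * μ := mul_le_mul_of_nonneg_left hmean hr0
      have h2 : 0 ≤ (1 - r) * μ := mul_nonneg (by linarith) hμpos.le
      rw [← mul_pow, ← neg_sub μ, neg_sq]
      exact pow_le_pow_left₀ h2 (by linarith) 2
    · rw [mul_zero]
      positivity
  have hr1 : 0 < (1 - r) ^ 2 := pow_pos (by linarith) 2
  have hV : 0 ≤ V := le_trans (sum_nonneg fun c _ =>
    mul_nonneg (rgvProb_nonneg c) (sq_nonneg _)) hsq
  rw [inv_mul_eq_div, le_div_iff₀ hr1]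
  have h3 : (1 - r) ^ 2 * prob n Q d Δ M (fun c => X c < θ) ≤ V / μ ^ 2 - 1 := by
    rw [le_sub_iff_add_le, le_div_iff₀ (by positivity)]
    linarith
  have h4 : V / μ ^ 2 ≤ V / B ^ 2 := by gcongr
  linarith

end Moments

lemma exp_neg_two_mul_le {η : ℝ} (h0 : 0 ≤ η) (h1 : η ≤ 1 / 4) :
    (1 - 4 * η ^ 2) * Real.exp (-(2 * η)) ≤ 1 - η := by
  have h2 : Real.exp (-(2 * η)) ≤ 1 / (1 + 2 * η) := by
    rw [Real.exp_neg, ← one_div]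
    have := Real.add_one_le_exp (2 * η)
    gcongr
    linarith
  have h3 : 0 ≤ 1 - 4 * η ^ 2 := by nlinarith
  calc (1 - 4 * η ^ 2) * Real.exp (-(2 * η)) ≤ (1 - 4 * η ^ 2) * (1 / (1 + 2 * η)) := by gcongr
    _ = 1 - 2 * η := by field_simp; ring
    _ ≤ 1 - η := by linarith

/-- The lower-tail bound at a fixed blocklength, under explicit largeness conditions. -/
lemma prob_Nenum_lt_le {α : Type} [Fintype α] [Nonempty α] {Q : α → ℝ} {n M : ℕ} (hn : 0 < n)
    {d : (α × α → ℝ) → ℝ} (hd : IsDistance d) {Δ R δ ε : ℝ} {P : α × α → ℝ} (hP : Joint Q P)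
    (hPn : IsTypeDist n P) (hPd : Δ < d P) (hrate : RateCond n Q d Δ R δ) (hε : 0 < ε)
    (hM : 1 ≤ M) (he : Real.exp (-(n * δ)) ≤ 1 / 5)
    (hball : 2 * M * (((n : ℝ) + 1) ^ (Fintype.card (α × α) + 2 * Fintype.card α) *
      Real.exp (-(n * (R + 2 * δ)))) ≤ Real.exp (-(n * δ)))
    (hmean : Real.exp (n * (2 * R - mutInf P - ε / 2)) ≤ (M : ℝ) * (M - 1) * Lsize n Q P)
    (hgap : 2 * Real.exp (n * ε / 2) ≤ Real.exp (n * (2 * R - mutInf P - ε / 2))) :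
    prob n Q d Δ M
        (fun c => ((Nenum n P c : ℕ) : ℝ) <
          (1 - 4 * deltan n δ ^ 2) * Real.exp (-(2 * deltan n δ)) *
            Real.exp ((n : ℝ) * (2 * R - mutInf P - ε))) ≤
        ((1 - Real.exp (-((n : ℝ) * ε / 2))) ^ 2)⁻¹ *
          (Real.exp (4 * deltan n δ) /
              ((1 - 4 * deltan n δ ^ 2) ^ 2 * (1 - Real.exp (-((n : ℝ) * δ))) ^ 2) *
              Real.exp (-((n : ℝ) * ε / 2)) +
            Real.exp (4 * deltan n δ) /
              ((1 - 4 * deltan n δ ^ 2) ^ 2 * (1 - Real.exp (-((n : ℝ) * δ))) ^ 4) - 1) := by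
  set e := Real.exp (-((n : ℝ) * δ)) with he_def
  set η := deltan n δ with hη_def
  have hηe : η = e / (1 - e) := rfl
  have he0 : 0 < e := Real.exp_pos _
  have h1e : 0 < 1 - e := by linarith
  have hη0 : 0 ≤ η := by rw [hηe]; positivity
  have hη1 : η ≤ 1 / 4 := by rw [hηe, div_le_iff₀ h1e]; linarith
  have hQ := hP.isDist
  have hTpos : (0 : ℝ) < #(typeClass n Q) := by
    exact_mod_cast card_typeClass_pos hn hQ (hP.isTypeDist hPn)
  have hn' : (0 : ℝ) < n := by exact_mod_cast hn
  have hM' : (1 : ℝ) ≤ M := by exact_mod_cast hM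
  set w := ((n : ℝ) + 1) ^ (Fintype.card (α × α) + 2 * Fintype.card α) *
      Real.exp (-(n * (R + 2 * δ))) with hw
  have hw0 : 0 ≤ w := by positivity
  have hv : ∀ x ∈ typeClass n Q,
      (#{z ∈ typeClass n Q | ¬ Δ < d (emp2 n z x)} : ℝ) ≤ w * #(typeClass n Q) :=
    fun x hx => card_ball_le hn hrate hx
  have hv0 : 0 ≤ w * #(typeClass n Q) := by positivity
  set s := (1 - e) * #(typeClass n Q) with hs_def
  have hs : 0 < s := by positivity
  have hsT : s ≤ #(typeClass n Q) := by
    rw [hs_def]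
    nlinarith
  have hwM : 2 * w ≤ 2 * M * w := by nlinarith
  have hvs : 2 * (w * #(typeClass n Q)) ≤ s := by
    rw [hs_def, ← mul_assoc]
    gcongr
    linarith
  have hF : ∀ (c : Fin M → Fin n → α) i, (∀ j < i, c j ∈ typeClass n Q) →
      s ≤ #(feasible n Q d Δ c i) := by
    intro c i hc
    refine le_trans ?_ (card_typeClass_sub_le_card_feasible hv hv0 hc)
    have : M * w ≤ e := by nlinarith
    rw [hs_def, ← mul_assoc]
    nlinarith
  set L := Lsize n Q P with hL
  set K := (M : ℝ) * (M - 1) with hK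
  have hKL : 0 < K * L := (Real.exp_pos _).trans_le hmean
  have hL0 : 0 ≤ L := by rw [hL, Lsize]; positivity
  have hK0 : 0 ≤ K := mul_nonneg (by positivity) (by linarith)
  have hA0 : 0 < 1 - 4 * η ^ 2 := by nlinarith
  set A := (1 - 4 * η ^ 2) * Real.exp (-(2 * η)) with hA_def
  have hA : 0 < A := by positivity
  set r := Real.exp (-((n : ℝ) * ε / 2)) with hr_def
  have hr1 : r < 1 := by
    rw [hr_def, Real.exp_lt_one_iff]
    have : 0 < n * ε / 2 := by positivity
    linarith
  have hr0 : 0 < r := Real.exp_pos _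
  have hone : ∑ c : Fin M → Fin n → α, rgvProb n Q d Δ c = 1 :=
    sum_rgvProb fun c i hc => by exact_mod_cast hs.trans_le (hF c i hc)
  have hB : A * (K * L) ≤ expect n Q d Δ M (fun c => (Nenum n P c : ℝ)) := by
    refine le_trans ?_ (le_expect_Nenum hs hv hv0 hvs hF hd hP hPd)
    have h1 : M * (2 * (w * #(typeClass n Q)) / s) ≤ η := by
      rw [hηe, hs_def, ← mul_assoc 2 w, mul_div_mul_right _ _ hTpos.ne', ← mul_div_assoc]
      gcongr
      linarith
    have h2 : A ≤ 1 - M * (2 * (w * #(typeClass n Q)) / s) :=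
      (exp_neg_two_mul_le hη0 hη1).trans (by linarith)
    calc A * (K * L) = K * (A * L) := by ring
      _ ≤ _ := by gcongr
  have hθ : A * Real.exp ((n : ℝ) * (2 * R - mutInf P - ε)) ≤ r * (A * (K * L)) := by
    have h1 : Real.exp ((n : ℝ) * (2 * R - mutInf P - ε)) =
        r * Real.exp (n * (2 * R - mutInf P - ε / 2)) := by
      rw [hr_def, ← Real.exp_add]
      congr 1
      ring
    rw [h1]
    calc _ = r * (A * Real.exp (n * (2 * R - mutInf P - ε / 2))) := by ring
      _ ≤ _ := by gcongr
  refine (prob_lt_le hone (mul_pos hA hKL) hr1 hr0.le hθ hB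
    (expect_Nenum_sq_le hn hs hsT hF hP)).trans ?_
  refine mul_le_mul_of_nonneg_left ?_ (by positivity)
  have hT2 : (#(typeClass2 n P) : ℝ) = L * #(typeClass n Q) ^ 2 := by
    rw [hL, Lsize, div_mul_cancel₀ _ (by positivity)]
  have hAinv : Real.exp (4 * η) / (1 - 4 * η ^ 2) ^ 2 = 1 / A ^ 2 := by
    rw [hA_def, mul_pow, ← Real.exp_nat_mul, div_eq_div_iff (by positivity) (by positivity),
      mul_comm, mul_assoc, ← Real.exp_add]
    push_cast
    rw [show 2 * -(2 * η) + 4 * η = 0 by ring, Real.exp_zero]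
    ring
  have hKL2 : 2 / (K * L) ≤ r := by
    have h1 : r = 1 / Real.exp (n * ε / 2) := by rw [hr_def, Real.exp_neg, one_div]
    rw [h1, div_le_div_iff₀ hKL (Real.exp_pos _)]
    linarith
  have hVB : (K * (2 * (s⁻¹ ^ 2 * (#(typeClass2 n P) : ℝ))) +
      K ^ 2 * (s⁻¹ ^ 4 * (#(typeClass2 n P) : ℝ) ^ 2)) / (A * (K * L)) ^ 2 =
      1 / A ^ 2 / (1 - e) ^ 2 * (2 / (K * L)) + 1 / A ^ 2 / (1 - e) ^ 4 := by
    have hKne : K ≠ 0 := fun h => by simp [h] at hKL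
    have hLne : L ≠ 0 := fun h => by simp [h] at hKL
    rw [hT2, hs_def]
    field_simp
  have hdiv (y : ℝ) : Real.exp (4 * η) / ((1 - 4 * η ^ 2) ^ 2 * y) = 1 / A ^ 2 / y := by
    rw [← div_div, hAinv]
  rw [hVB, hdiv, hdiv]
  gcongr

lemma eventually_mul_pow_le_exp (C : ℝ) (k : ℕ) {a : ℝ} (ha : 0 < a) :
    ∀ᶠ n : ℕ in atTop, C * ((n : ℝ) + 1) ^ k ≤ Real.exp (n * a) := by
  have h1 : Tendsto (fun n : ℕ => (n : ℝ) + 1) atTop atTop :=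
    tendsto_atTop_add_const_right _ _ tendsto_natCast_atTop_atTop
  have h2 := ((isLittleO_pow_exp_pos_mul_atTop k ha).comp_tendsto h1).def
    (c := (Real.exp a * (|C| + 1))⁻¹) (by positivity)
  filter_upwards [h2] with n hn
  simp only [Function.comp_apply, Real.norm_eq_abs, abs_pow, Real.abs_exp] at hn
  rw [abs_of_pos (by positivity), inv_mul_eq_div, le_div_iff₀ (by positivity)] at hn
  have h3 : Real.exp (a * (n + 1)) = Real.exp (n * a) * Real.exp a := by
    rw [← Real.exp_add]; congr 1; ring
  rw [h3, ← mul_assoc] at hn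
  have h4 : ((n : ℝ) + 1) ^ k * (|C| + 1) ≤ Real.exp (n * a) := by
    refine le_of_mul_le_mul_right (le_of_eq_of_le ?_ hn) (Real.exp_pos a)
    ring
  refine le_trans ?_ h4
  rw [mul_comm]
  gcongr
  linarith [le_abs_self C]

lemma Mof_bounds {R : ℝ} (hR : 0 < R) {n : ℕ} (hn : 0 < n) :
    Real.exp (n * R) ≤ Mof R n ∧ (Mof R n : ℝ) ≤ 2 * Real.exp (n * R) ∧ 2 ≤ Mof R n := by
  have hn' : (0 : ℝ) < n := by exact_mod_cast hn
  have h1 : 1 < Real.exp (n * R) := Real.one_lt_exp_iff.2 (by positivity)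
  refine ⟨Nat.le_ceil _, ?_, ?_⟩
  · have := Nat.ceil_lt_add_one (Real.exp_pos (n * R)).le
    unfold Mof
    linarith
  · have : 1 < Mof R n := Nat.lt_ceil.2 (by simpa using h1)
    exact this

/-- The blocklength is eventually large enough for the lower-tail bound. -/
lemma eventually_prob_Nenum_lt_le {α : Type} [Fintype α] [Nonempty α] {Q : α → ℝ}
    {d : (α × α → ℝ) → ℝ} (hd : IsDistance d) {Δ R δ ε : ℝ} (hR : 0 < R) (hδ : 0 < δ)
    (hε : 0 < ε) {P : α × α → ℝ} (hP : Joint Q P) (hPI : mutInf P < 2 * R - ε) (hPd : Δ < d P) :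
    ∀ᶠ n : ℕ in atTop, IsTypeDist n P → RateCond n Q d Δ R δ →
      prob n Q d Δ (Mof R n)
        (fun c => ((Nenum n P c : ℕ) : ℝ) <
          (1 - 4 * deltan n δ ^ 2) * Real.exp (-(2 * deltan n δ)) *
            Real.exp ((n : ℝ) * (2 * R - mutInf P - ε))) ≤
        ((1 - Real.exp (-((n : ℝ) * ε / 2))) ^ 2)⁻¹ *
          (Real.exp (4 * deltan n δ) /
              ((1 - 4 * deltan n δ ^ 2) ^ 2 * (1 - Real.exp (-((n : ℝ) * δ))) ^ 2) *
              Real.exp (-((n : ℝ) * ε / 2)) +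
            Real.exp (4 * deltan n δ) /
              ((1 - 4 * deltan n δ ^ 2) ^ 2 * (1 - Real.exp (-((n : ℝ) * δ))) ^ 4) - 1) := by
  filter_upwards [eventually_gt_atTop 0, eventually_mul_pow_le_exp 5 0 hδ,
    eventually_mul_pow_le_exp 4 (Fintype.card (α × α) + 2 * Fintype.card α) hδ,
    eventually_mul_pow_le_exp 2 (Fintype.card (α × α)) (half_pos hε),
    eventually_mul_pow_le_exp 2 0 (show 0 < 2 * R - mutInf P - ε by linarith)]
    with n hn h5 hball hmean hgap hPn hrate
  obtain ⟨hM1, hM2, hM3⟩ := Mof_bounds hR hn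
  have hM3' : (2 : ℝ) ≤ Mof R n := by exact_mod_cast hM3
  rw [pow_zero, mul_one] at h5 hgap
  have hn' : (0 : ℝ) < n := by exact_mod_cast hn
  refine prob_Nenum_lt_le hn hd hP hPn hPd hrate hε (by lia) ?_ ?_ ?_ ?_
  · rw [Real.exp_neg, ← one_div]
    gcongr
  · have e1 : Real.exp (-(n * (R + 2 * δ))) =
        Real.exp (-(n * δ)) * (Real.exp (n * R))⁻¹ * (Real.exp (n * δ))⁻¹ := by
      rw [← Real.exp_neg, ← Real.exp_neg, ← Real.exp_add, ← Real.exp_add]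
      congr 1
      ring
    set p := ((n : ℝ) + 1) ^ (Fintype.card (α × α) + 2 * Fintype.card α)
    have hp : 0 ≤ p := by positivity
    calc _ ≤ 2 * (2 * Real.exp (n * R)) * (p * Real.exp (-(n * (R + 2 * δ)))) := by gcongr
      _ = Real.exp (-(n * δ)) * (4 * p * (Real.exp (n * δ))⁻¹) := by
        rw [e1]; field_simp; ring
      _ ≤ Real.exp (-(n * δ)) * 1 := by
        gcongr
        rw [← div_eq_mul_inv]
        exact div_le_one_of_le₀ hball (Real.exp_pos _).le
      _ = _ := mul_one _
  · have hTpos : (0 : ℝ) < #(typeClass n Q) := by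
      exact_mod_cast card_typeClass_pos hn hP.isDist (hP.isTypeDist hPn)
    have h1 := hP.exp_mul_le_card_typeClass2 hn hPn
    rw [← le_div_iff₀ (by positivity), mul_div_assoc] at h1
    change _ ≤ _ * Lsize n Q P at h1
    have hK : Real.exp (n * R) ^ 2 ≤ 2 * ((Mof R n : ℝ) * (Mof R n - 1)) := by
      have : Real.exp (n * R) ^ 2 ≤ (Mof R n : ℝ) ^ 2 := by gcongr
      nlinarith
    have hL0 : 0 ≤ Lsize n Q P := by unfold Lsize; positivity
    set p := ((n : ℝ) + 1) ^ Fintype.card (α × α)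
    have hp : 0 < p := by positivity
    refine le_of_mul_le_mul_left ?_ (show 0 < Real.exp (n * (ε / 2)) from Real.exp_pos _)
    calc Real.exp (n * (ε / 2)) * Real.exp (n * (2 * R - mutInf P - ε / 2))
        = Real.exp (n * R) ^ 2 * Real.exp (-(n * mutInf P)) := by
          rw [← Real.exp_nat_mul, ← Real.exp_add, ← Real.exp_add]
          congr 1
          push_cast
          ring
      _ ≤ 2 * ((Mof R n : ℝ) * (Mof R n - 1)) * (p * Lsize n Q P) := by
          gcongr
          exact (by positivity : (0 : ℝ) ≤ Real.exp (n * R) ^ 2).trans hK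
      _ = 2 * p * ((Mof R n : ℝ) * (Mof R n - 1) * Lsize n Q P) := by ring
      _ ≤ _ := by
          gcongr
          exact mul_nonneg (mul_nonneg (by positivity) (by linarith)) hL0
  · have : Real.exp (n * (2 * R - mutInf P - ε / 2)) =
        Real.exp (n * (2 * R - mutInf P - ε)) * Real.exp (n * ε / 2) := by
      rw [← Real.exp_add]
      congr 1
      ring
    rw [this]
    gcongr

lemma tendsto_exp_neg_mul {a : ℝ} (ha : 0 < a) :
    Tendsto (fun n : ℕ => Real.exp (-((n : ℝ) * a))) atTop (nhds 0) :=
  Real.tendsto_exp_neg_atTop_nhds_zero.comp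
    (tendsto_natCast_atTop_atTop.atTop_mul_const ha)

lemma tendsto_deltan {δ : ℝ} (hδ : 0 < δ) :
    Tendsto (fun n : ℕ => deltan n δ) atTop (nhds 0) := by
  have h := tendsto_exp_neg_mul hδ
  have h' := h.div (h.const_sub 1) (by norm_num)
  rw [zero_div] at h'
  exact h'

/-- The lower-tail bound vanishes as the blocklength grows. -/
lemma tendsto_tail_bound {δ ε : ℝ} (hδ : 0 < δ) (hε : 0 < ε) :
    Tendsto (fun n : ℕ => ((1 - Real.exp (-((n : ℝ) * ε / 2))) ^ 2)⁻¹ *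
          (Real.exp (4 * deltan n δ) /
              ((1 - 4 * deltan n δ ^ 2) ^ 2 * (1 - Real.exp (-((n : ℝ) * δ))) ^ 2) *
              Real.exp (-((n : ℝ) * ε / 2)) +
            Real.exp (4 * deltan n δ) /
              ((1 - 4 * deltan n δ ^ 2) ^ 2 * (1 - Real.exp (-((n : ℝ) * δ))) ^ 4) - 1))
      atTop (nhds 0) := by
  have he := tendsto_exp_neg_mul hδ
  have hr : Tendsto (fun n : ℕ => Real.exp (-((n : ℝ) * ε / 2))) atTop (nhds 0) := by
    simpa only [mul_div_assoc] using tendsto_exp_neg_mul (half_pos hε)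
  have hη := tendsto_deltan hδ
  have h1 := (((hη.pow 2).const_mul 4).const_sub 1).pow 2
  have h2 := (Real.continuous_exp.tendsto _).comp (hη.const_mul 4)
  have h := (((hr.const_sub 1).pow 2).inv₀ (by norm_num)).mul
    ((((h2.div (h1.mul ((he.const_sub 1).pow 2)) (by norm_num)).mul hr).add
      (h2.div (h1.mul ((he.const_sub 1).pow 4)) (by norm_num))).sub_const 1)
  convert h using 2 <;> simp

lemma tendsto_nseq {D : ℕ} (hD : 0 < D) : Tendsto (nseq D) atTop atTop :=
  tendsto_atTop_mono (fun t => (Nat.le_succ t).trans (Nat.le_mul_of_pos_left _ hD)) tendsto_id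

lemma IsTypeDist.nseq {β : Type} {D : ℕ} {p : β → ℝ} (h : IsTypeDist D p) (t : ℕ) :
    IsTypeDist (nseq D t) p := by
  intro b
  obtain ⟨k, hk⟩ := h b
  refine ⟨k * (t + 1), ?_⟩
  simp only [RGV.nseq]
  push_cast
  rw [← hk]
  ring

end RGV

open RGV in
/-- The probability that the type enumerator falls well below its
typical value vanishes, with the explicit finite-`n` bound of the paper. -/
theorem statement11 {α : Type} [Fintype α] [Nonempty α]
    (Q : α → ℝ) (D : ℕ) (hD : 0 < D) (hQ : IsDist Q) (hQD : IsTypeDist D Q)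
    (d : (α × α → ℝ) → ℝ) (hd : IsDistance d) (Δ : ℝ)
    (R δ ε : ℝ) (hR : 0 < R) (hδ : 0 < δ) (hε : 0 < ε)
    (P : α × α → ℝ) (hP : Joint Q P) (hPD : IsTypeDist D P)
    (hPI : mutInf P < 2 * R - ε) (hPd : Δ < d P)
    (hrate : ∀ t : ℕ, RateCond (nseq D t) Q d Δ R δ) :
    (∃ T : ℕ, ∀ t : ℕ, T ≤ t →
      prob (nseq D t) Q d Δ (Mof R (nseq D t))
        (fun c => ((Nenum (nseq D t) P c : ℕ) : ℝ) <
          (1 - 4 * deltan (nseq D t) δ ^ 2) * Real.exp (-(2 * deltan (nseq D t) δ)) *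
            Real.exp ((nseq D t : ℝ) * (2 * R - mutInf P - ε))) ≤
        ((1 - Real.exp (-((nseq D t : ℝ) * ε / 2))) ^ 2)⁻¹ *
          (Real.exp (4 * deltan (nseq D t) δ) /
              ((1 - 4 * deltan (nseq D t) δ ^ 2) ^ 2 *
                (1 - Real.exp (-((nseq D t : ℝ) * δ))) ^ 2) *
              Real.exp (-((nseq D t : ℝ) * ε / 2)) +
            Real.exp (4 * deltan (nseq D t) δ) /
              ((1 - 4 * deltan (nseq D t) δ ^ 2) ^ 2 *
                (1 - Real.exp (-((nseq D t : ℝ) * δ))) ^ 4) - 1)) ∧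
    Filter.Tendsto
      (fun t : ℕ =>
        prob (nseq D t) Q d Δ (Mof R (nseq D t))
          (fun c => ((Nenum (nseq D t) P c : ℕ) : ℝ) <
            (1 - 4 * deltan (nseq D t) δ ^ 2) * Real.exp (-(2 * deltan (nseq D t) δ)) *
              Real.exp ((nseq D t : ℝ) * (2 * R - mutInf P - ε))))
      Filter.atTop (nhds 0) := by
  have hbound := ((tendsto_nseq hD).eventually
    (eventually_prob_Nenum_lt_le hd hR hδ hε hP hPI hPd)).mono
      fun t ht => ht (hPD.nseq t) (hrate t)
  exact ⟨eventually_atTop.1 hbound,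
    squeeze_zero' (Eventually.of_forall fun t => prob_nonneg _) hbound
      ((tendsto_tail_bound hδ hε).comp (tendsto_nseq hD))⟩
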